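/- Let Σ ∈ ℝ^{d×d} be symmetric positive definite with eigendecomposition Σ = UΓUᵀ, Γ = diag(γ₁,…,γ_d), γ_i > 0, and μ = N(0,Σ). For every N ∈ ℕ there exist constants C_N, D_N, ε_N > 0 such that for every ε ∈ [0, ε_N] and every sequence (c_n)_{n≥0} with c_n ≥ 0, c_{n+1} ≤ ε·c_n for all n, and c_N > 0, the dot-product kernel K(x,y) = Σ_{n≥0} (c_n/n!)·(xᵀy)^n defines a positive self-adjoint trace-class integral operator on L²(μ), and the following holds for every α ∈ ℕ^d with |α| = N: setting λ := c_N·∏_i γ_i^{α_i} and V := span{ h_β^{(Σ)} : |β| = N, ∏_i γ_i^{β_i} = ∏_i γ_i^{α_i} }, the number of eigenvalues of K (counted with multiplicity) lying in [λ(1 − C_N ε), λ(1 + C_N ε)] is exactly dim V, and, with V′ the span of eigenfunctions corresponding to those eigenvalues, dim V′ = dim V and ‖P_V − P_{V′}‖_op ≤ D_N ε, where P_W denotes the orthogonal projection onto W. -/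

import Mathlib

open MeasureTheory
open scoped InnerProductSpace

/-- The monic probabilist's Hermite polynomial `He`, as a real function. -/
noncomputable def He (n : ℕ) (x : ℝ) : ℝ := Polynomial.aeval x (Polynomial.hermite n)

/-- The normalized probabilist's Hermite polynomial `h_n := He_n / √(n!)`. -/
noncomputable def hermN (n : ℕ) (x : ℝ) : ℝ := He n x / Real.sqrt (Nat.factorial n)

/-- The Gaussian measure `N(0, Σ)` on `ℝ^d`, for `Σ = U Γ Uᵀ`, realized as the law of
`x = U Γ^{1/2} z` with `z` a standard Gaussian vector. -/
noncomputable def gaussianVec (d : ℕ) (U : Matrix (Fin d) (Fin d) ℝ) (γv : Fin d → ℝ) :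
    Measure (Fin d → ℝ) :=
  Measure.map (fun z i => ∑ j, U i j * (Real.sqrt (γv j) * z j))
    (Measure.pi fun _ : Fin d => ProbabilityTheory.gaussianReal 0 1)

/-- The multivariate Hermite polynomial `h_β^{(Σ)}(x) = ∏_i h_{β_i}(z_i)`,
`z = Γ^{−1/2}Uᵀx`. -/
noncomputable def hermMulti (d : ℕ) (U : Matrix (Fin d) (Fin d) ℝ) (γv : Fin d → ℝ)
    (β : Fin d → ℕ) (x : Fin d → ℝ) : ℝ :=
  ∏ i, hermN (β i) ((∑ j, U j i * x j) / Real.sqrt (γv i))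

/-- `P` is the orthogonal projection onto the submodule `W`. -/
def IsOrthoProj {H : Type*} [NormedAddCommGroup H] [InnerProductSpace ℝ H]
    (P : H →L[ℝ] H) (W : Submodule ℝ H) : Prop :=
  (∀ x, P x ∈ W) ∧ (∀ x ∈ W, P x = x) ∧ ∀ x y, ⟪P x, y⟫_ℝ = ⟪x, P y⟫_ℝ

/-- The span in `L²(μ)` of the multivariate Hermite polynomials `h_β^{(Σ)}` of total
degree `N` whose HEA eigenvalue agrees with that of `α`. -/
noncomputable def hermiteLevelSpan (d : ℕ) (U : Matrix (Fin d) (Fin d) ℝ)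
    (γv : Fin d → ℝ) (N : ℕ) (α : Fin d → ℕ) :
    Submodule ℝ (Lp ℝ 2 (gaussianVec d U γv)) :=
  Submodule.span ℝ
    {f : Lp ℝ 2 (gaussianVec d U γv) |
      ∃ β : Fin d → ℕ, (∑ i, β i) = N ∧ (∏ i, γv i ^ β i) = (∏ i, γv i ^ α i) ∧
        (f : (Fin d → ℝ) → ℝ) =ᵐ[gaussianVec d U γv] hermMulti d U γv β}

/-- The sum of the eigenspaces of `T` for eigenvalues in `[lo, hi]` (the span of the
eigenfunctions with eigenvalue in that interval). -/
noncomputable def eigSpanIcc (d : ℕ) (U : Matrix (Fin d) (Fin d) ℝ) (γv : Fin d → ℝ)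
    (T : Lp ℝ 2 (gaussianVec d U γv) →L[ℝ] Lp ℝ 2 (gaussianVec d U γv))
    (lo hi : ℝ) : Submodule ℝ (Lp ℝ 2 (gaussianVec d U γv)) :=
  ⨆ lam ∈ Set.Icc lo hi,
    Module.End.eigenspace
      (T : Lp ℝ 2 (gaussianVec d U γv) →ₗ[ℝ] Lp ℝ 2 (gaussianVec d U γv)) lam

section CompactSpectral

open Module.End

variable {H : Type*} [NormedAddCommGroup H] [InnerProductSpace ℝ H]

/-- The sum of the eigenspaces of `T` with eigenvalue in `s`. -/
def eigSpan (T : H →L[ℝ] H) (s : Set ℝ) : Submodule ℝ H :=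
  ⨆ lam ∈ s, eigenspace (T : H →ₗ[ℝ] H) lam

theorem eigenspace_le_eigSpan (T : H →L[ℝ] H) {s : Set ℝ} {μ : ℝ} (hμ : μ ∈ s) :
    eigenspace (T : H →ₗ[ℝ] H) μ ≤ eigSpan T s :=
  le_biSup (fun lam => eigenspace (T : H →ₗ[ℝ] H) lam) hμ

variable [CompleteSpace H]

instance completeSpace_eigenspace (T : H →L[ℝ] H) (μ : ℝ) :
    CompleteSpace (eigenspace (T : H →ₗ[ℝ] H) μ) := by
  have h : IsClosed ((eigenspace (T : H →ₗ[ℝ] H) μ : Submodule ℝ H) : Set H) := by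
    have : ((eigenspace (T : H →ₗ[ℝ] H) μ : Submodule ℝ H) : Set H) = {x | T x = μ • x} := by
      ext x
      simp
    rw [this]
    exact isClosed_eq T.continuous (continuous_const_smul μ)
  exact h.completeSpace_coe

/-- Parseval's identity for the eigenspaces of a compact self-adjoint operator. -/
theorem hasSum_norm_sq_starProjection_eigenspace {T : H →L[ℝ] H} (hc : IsCompactOperator T)
    (hs : (T : H →ₗ[ℝ] H).IsSymmetric) (x : H) :
    HasSum (fun μ : ℝ => ‖(eigenspace (T : H →ₗ[ℝ] H) μ).starProjection x‖ ^ 2) (‖x‖ ^ 2) := by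
  classical
  have hsum : IsHilbertSum ℝ (fun μ : ℝ => eigenspace (T : H →ₗ[ℝ] H) μ)
      (fun μ => (eigenspace (T : H →ₗ[ℝ] H) μ).subtypeₗᵢ) := by
    refine IsHilbertSum.mkInternal _ hs.orthogonalFamily_eigenspaces ?_
    have h := ContinuousLinearMap.orthogonalComplement_iSup_eigenspaces_eq_bot hc hs
    rw [← Submodule.orthogonal_orthogonal_eq_closure, h, Submodule.bot_orthogonal_eq_top]
  have hproj : ∀ μ : ℝ, ((hsum.linearIsometryEquiv x) μ : H)
      = (eigenspace (T : H →ₗ[ℝ] H) μ).starProjection x := by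
    intro μ
    symm
    refine Submodule.eq_starProjection_of_mem_of_inner_eq_zero (Subtype.coe_prop _) ?_
    intro w hw
    have h1 : ⟪x, w⟫_ℝ = ⟪(hsum.linearIsometryEquiv x) μ, (⟨w, hw⟩ : eigenspace (T : H →ₗ[ℝ] H) μ)⟫_ℝ := by
      rw [← lp.inner_single_right, ← hsum.linearIsometryEquiv.symm.inner_map_map]
      simp
    rw [inner_sub_left, h1]
    simp [Submodule.coe_inner]
  have h2 := lp.hasSum_norm (p := 2) (by norm_num) (hsum.linearIsometryEquiv x)
  rw [LinearIsometryEquiv.norm_map] at h2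
  simp only [ENNReal.toReal_ofNat, Real.rpow_ofNat] at h2
  refine h2.congr_fun fun μ => ?_
  rw [← hproj, Submodule.coe_norm]

theorem starProjection_eigenspace_apply {T : H →L[ℝ] H} (hs : (T : H →ₗ[ℝ] H).IsSymmetric)
    (x : H) (μ : ℝ) :
    (eigenspace (T : H →ₗ[ℝ] H) μ).starProjection (T x)
      = μ • (eigenspace (T : H →ₗ[ℝ] H) μ).starProjection x := by
  refine Submodule.eq_starProjection_of_mem_of_inner_eq_zero
    (Submodule.smul_mem _ _ (Submodule.starProjection_apply_mem _ _)) ?_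
  intro w hw
  have hw' : T w = μ • w := by simpa [mem_eigenspace_iff] using hw
  have h1 : ⟪T x, w⟫_ℝ = μ * ⟪x, w⟫_ℝ := by
    have := hs x w
    simp only [ContinuousLinearMap.coe_coe] at this
    rw [this, hw', inner_smul_right]
  have h2 := Submodule.starProjection_inner_eq_zero (K := eigenspace (T : H →ₗ[ℝ] H) μ) x w hw
  rw [inner_sub_left] at h2
  rw [inner_sub_left, inner_smul_left, h1]
  simp only [conj_trivial]
  linear_combination μ * h2

theorem hasSum_sub_sq_mul_norm_sq_starProjection_eigenspace {T : H →L[ℝ] H}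
    (hc : IsCompactOperator T) (hs : (T : H →ₗ[ℝ] H).IsSymmetric) (x : H) (lam : ℝ) :
    HasSum (fun μ : ℝ => (μ - lam) ^ 2 * ‖(eigenspace (T : H →ₗ[ℝ] H) μ).starProjection x‖ ^ 2)
      (‖T x - lam • x‖ ^ 2) := by
  convert hasSum_norm_sq_starProjection_eigenspace hc hs (T x - lam • x) using 2 with μ
  rw [map_sub, starProjection_eigenspace_apply hs, map_smul, ← sub_smul, norm_smul, mul_pow,
    Real.norm_eq_abs, sq_abs]

theorem starProjection_eigenspace_eq_zero_of_mem_eigSpan {T : H →L[ℝ] H}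
    (hs : (T : H →ₗ[ℝ] H).IsSymmetric) {s : Set ℝ} {x : H} (hx : x ∈ eigSpan T s) {μ : ℝ}
    (hμ : μ ∉ s) : (eigenspace (T : H →ₗ[ℝ] H) μ).starProjection x = 0 := by
  have hle : eigSpan T s ≤ (eigenspace (T : H →ₗ[ℝ] H) μ)ᗮ := by
    refine iSup₂_le fun lam hlam => ?_
    have hne : lam ≠ μ := fun h => hμ (h ▸ hlam)
    exact hs.orthogonalFamily_eigenspaces.isOrtho hne
  rw [Submodule.starProjection_apply_eq_zero_iff]
  exact hle hx

theorem norm_apply_sub_smul_le_of_mem_eigSpan {T : H →L[ℝ] H}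
    (hc : IsCompactOperator T) (hs : (T : H →ₗ[ℝ] H).IsSymmetric) {s : Set ℝ} {lam r : ℝ}
    (hr : 0 ≤ r) (hsr : ∀ μ ∈ s, |μ - lam| ≤ r) {x : H} (hx : x ∈ eigSpan T s) :
    ‖T x - lam • x‖ ≤ r * ‖x‖ := by
  have h1 := hasSum_sub_sq_mul_norm_sq_starProjection_eigenspace hc hs x lam
  have h2 := (hasSum_norm_sq_starProjection_eigenspace hc hs x).mul_left (r ^ 2)
  have h3 : ‖T x - lam • x‖ ^ 2 ≤ (r * ‖x‖) ^ 2 := by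
    rw [mul_pow]
    refine hasSum_le (fun μ => ?_) h1 h2
    by_cases hμ : μ ∈ s
    · have := sq_le_sq' (abs_le.mp (hsr μ hμ)).1 (abs_le.mp (hsr μ hμ)).2
      gcongr
    · simp [starProjection_eigenspace_eq_zero_of_mem_eigSpan hs hx hμ]
  exact (sq_le_sq₀ (norm_nonneg _) (by positivity)).mp h3

theorem norm_sub_starProjection_eigSpan_le {T : H →L[ℝ] H}
    (hc : IsCompactOperator T) (hs : (T : H →ₗ[ℝ] H).IsSymmetric) {s : Set ℝ} {lam δ : ℝ}
    (hδ : 0 ≤ δ) (hsδ : ∀ μ ∉ s, HasEigenvalue (T : H →ₗ[ℝ] H) μ → δ ≤ |μ - lam|)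
    [(eigSpan T s).HasOrthogonalProjection] (x : H) :
    δ * ‖x - (eigSpan T s).starProjection x‖ ≤ ‖T x - lam • x‖ := by
  set z := x - (eigSpan T s).starProjection x with hz
  have h1 := hasSum_sub_sq_mul_norm_sq_starProjection_eigenspace hc hs x lam
  have h2 := (hasSum_norm_sq_starProjection_eigenspace hc hs z).mul_left (δ ^ 2)
  have h3 : (δ * ‖z‖) ^ 2 ≤ ‖T x - lam • x‖ ^ 2 := by
    rw [mul_pow]
    refine hasSum_le (fun μ => ?_) h2 h1
    by_cases hμ : μ ∈ s
    · have : (eigenspace (T : H →ₗ[ℝ] H) μ).starProjection z = 0 := by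
        rw [Submodule.starProjection_apply_eq_zero_iff]
        exact Submodule.orthogonal_le (eigenspace_le_eigSpan T hμ)
          (Submodule.sub_starProjection_mem_orthogonal x)
      rw [this]
      have : 0 ≤ (μ - lam) ^ 2 * ‖(eigenspace (T : H →ₗ[ℝ] H) μ).starProjection x‖ ^ 2 := by
        positivity
      simpa using this
    · have : (eigenspace (T : H →ₗ[ℝ] H) μ).starProjection z
          = (eigenspace (T : H →ₗ[ℝ] H) μ).starProjection x := by
        rw [hz, map_sub, starProjection_eigenspace_eq_zero_of_mem_eigSpan hs
          (Submodule.starProjection_apply_mem _ x) hμ, sub_zero]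
      rw [this]
      by_cases he : HasEigenvalue (T : H →ₗ[ℝ] H) μ
      · rw [← sq_abs (μ - lam)]
        have := hsδ μ hμ he
        gcongr
      · rw [hasEigenvalue_iff, not_not] at he
        have : (eigenspace (T : H →ₗ[ℝ] H) μ).starProjection x = 0 := by
          exact (Submodule.mem_bot ℝ).mp
            (he.le (Submodule.starProjection_apply_mem (eigenspace (T : H →ₗ[ℝ] H) μ) x))
        simp [this]
  exact (sq_le_sq₀ (by positivity) (norm_nonneg _)).mp h3

end CompactSpectral

section Perturbation

variable {H : Type*} [NormedAddCommGroup H] [InnerProductSpace ℝ H]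

theorem isOrthoProj_starProjection (W : Submodule ℝ H) [W.HasOrthogonalProjection] :
    IsOrthoProj W.starProjection W :=
  ⟨fun x => Submodule.starProjection_apply_mem W x,
    fun _ hx => Submodule.starProjection_eq_self_iff.mpr hx,
    fun x y => Submodule.inner_starProjection_left_eq_right W x y⟩

theorem norm_starProjection_sub_starProjection_le {V E : Submodule ℝ H}
    [V.HasOrthogonalProjection] [E.HasOrthogonalProjection] {a b : ℝ} (ha : 0 ≤ a) (hb : 0 ≤ b)
    (hE : ∀ x ∈ E, ‖x - V.starProjection x‖ ≤ a * ‖x‖)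
    (hV : ∀ v ∈ V, ‖v - E.starProjection v‖ ≤ b * ‖v‖) :
    ‖V.starProjection - E.starProjection‖ ≤ a + b := by
  refine ContinuousLinearMap.opNorm_le_bound _ (by positivity) fun x => ?_
  have h1 : ‖V.starProjection x - E.starProjection (V.starProjection x)‖ ≤ b * ‖x‖ :=
    (hV _ (Submodule.starProjection_apply_mem V x)).trans
      (mul_le_mul_of_nonneg_left (Submodule.norm_starProjection_apply_le V x) hb)
  set y := x - V.starProjection x with hy
  have h2 : ‖E.starProjection y‖ ≤ a * ‖x‖ := by
    set q := E.starProjection y with hq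
    have hqE : q ∈ E := Submodule.starProjection_apply_mem E y
    have e1 : ⟪q, q⟫_ℝ = ⟪q - V.starProjection q, x⟫_ℝ := by
      have : ⟪q, q⟫_ℝ = ⟪q, y⟫_ℝ := by
        conv_lhs => rw [hq, Submodule.inner_starProjection_left_eq_right,
          Submodule.starProjection_eq_self_iff.mpr hqE, real_inner_comm]
      rw [this, hy, inner_sub_right, inner_sub_left,
        Submodule.inner_starProjection_left_eq_right (K := V)]
    have e2 : ‖q‖ * ‖q‖ ≤ (a * ‖x‖) * ‖q‖ := by
      rw [← real_inner_self_eq_norm_mul_norm, e1]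
      refine (real_inner_le_norm _ _).trans ?_
      calc _ ≤ (a * ‖q‖) * ‖x‖ := mul_le_mul_of_nonneg_right (hE q hqE) (norm_nonneg _)
        _ = _ := by ring
    rcases (norm_nonneg q).eq_or_lt with h0 | h0
    · rw [← h0]; positivity
    · exact le_of_mul_le_mul_right e2 h0
  have h3 : (V.starProjection - E.starProjection) x
      = (V.starProjection x - E.starProjection (V.starProjection x)) - E.starProjection y := by
    rw [hy, map_sub, sub_apply]
    abel
  rw [h3]
  calc _ ≤ _ := norm_sub_le _ _
    _ ≤ b * ‖x‖ + a * ‖x‖ := add_le_add h1 h2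
    _ = _ := by ring

theorem injective_starProjection_of_norm_sub_le {V E : Submodule ℝ H}
    [V.HasOrthogonalProjection] {a : ℝ} (ha : a < 1)
    (hE : ∀ x ∈ E, ‖x - V.starProjection x‖ ≤ a * ‖x‖) :
    Function.Injective
      ((V.orthogonalProjectionOnto : H →ₗ[ℝ] V).domRestrict E) := by
  rw [injective_iff_map_eq_zero]
  rintro ⟨x, hx⟩ h
  have h0 : V.starProjection x = 0 := by
    rw [Submodule.starProjection_apply_eq_zero_iff]
    simpa using h
  have h1 := hE x hx
  rw [h0, sub_zero] at h1
  have h2 : ‖x‖ = 0 := by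
    by_contra hne
    have : 0 < ‖x‖ := lt_of_le_of_ne (norm_nonneg _) (Ne.symm hne)
    nlinarith
  exact Subtype.ext (norm_eq_zero.mp h2)

/-- `A₀` lives on `W` and is bounded below there by a multiple of `ε⁻¹`, and `R` is `O(ε)`. -/
structure IsScaleSeparated (W : Submodule ℝ H) (κ K ε : ℝ) (A₀ R : H →L[ℝ] H) : Prop where
  apply_mem : ∀ x, A₀ x ∈ W
  apply_eq_zero : ∀ x ∈ Wᗮ, A₀ x = 0
  coercive : ∀ u ∈ W, κ * ‖u‖ ≤ ε * ‖A₀ u‖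
  norm_le : ‖R‖ ≤ K * ε

variable {ι : Type*} [Fintype ι] {e φ : ι → H} {ℓ : ι → ℝ} {W : Submodule ℝ H}

/-- The finite-rank operator `∑ ℓᵢ φᵢ ⊗ φᵢ`. -/
noncomputable def diagOp (ℓ : ι → ℝ) (φ : ι → H) : H →L[ℝ] H :=
  ∑ i, ℓ i • InnerProductSpace.rankOne ℝ (φ i) (φ i)

theorem diagOp_apply (ℓ : ι → ℝ) (φ : ι → H) (x : H) :
    diagOp ℓ φ x = ∑ i, (ℓ i * ⟪φ i, x⟫_ℝ) • φ i := by
  simp [diagOp, mul_smul]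

section Coordinates

variable {κ K ε L B M θ μ : ℝ} {A₀ R : H →L[ℝ] H} {x : H}

theorem norm_starProjection_le_of_approx_eigenvector [W.HasOrthogonalProjection]
    (h : IsScaleSeparated W κ K ε A₀ R) (hκ : 0 < κ) (hK : 0 ≤ K) (hε : 0 ≤ ε) (hε1 : ε ≤ 1)
    (hL : ‖diagOp ℓ φ‖ ≤ L) (hμ : |μ| ≤ M) (hθ : θ ≤ 1)
    (hx : ‖(A₀ + diagOp ℓ φ + R) x - μ • x‖ ≤ θ * ‖x‖) :
    ‖W.starProjection x‖ ≤ ((M + 1 + L + K) / κ) * ε * ‖x‖ := by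
  have h0 : A₀ (W.starProjection x) = A₀ x := by
    have := h.apply_eq_zero _ (Submodule.sub_starProjection_mem_orthogonal (K := W) x)
    rw [map_sub, sub_eq_zero] at this
    exact this.symm
  have h1 : A₀ x = ((A₀ + diagOp ℓ φ + R) x - μ • x) + μ • x - diagOp ℓ φ x - R x := by
    simp only [add_apply]
    abel
  have hR : ‖R x‖ ≤ K * ‖x‖ :=
    (R.le_of_opNorm_le h.norm_le x).trans
      (mul_le_mul_of_nonneg_right (mul_le_of_le_one_right hK hε1) (norm_nonneg _))
  have h2 : ‖A₀ x‖ ≤ (M + 1 + L + K) * ‖x‖ := by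
    rw [h1]
    have t1 := norm_sub_le (((A₀ + diagOp ℓ φ + R) x - μ • x) + μ • x - diagOp ℓ φ x) (R x)
    have t2 := norm_sub_le (((A₀ + diagOp ℓ φ + R) x - μ • x) + μ • x) (diagOp ℓ φ x)
    have t3 := norm_add_le ((A₀ + diagOp ℓ φ + R) x - μ • x) (μ • x)
    have t4 := (diagOp ℓ φ).le_of_opNorm_le hL x
    have t5 : ‖μ • x‖ ≤ M * ‖x‖ := by
      rw [norm_smul, Real.norm_eq_abs]
      exact mul_le_mul_of_nonneg_right hμ (norm_nonneg _)
    have t6 : θ * ‖x‖ ≤ 1 * ‖x‖ := mul_le_mul_of_nonneg_right hθ (norm_nonneg _)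
    linarith
  have h3 := h.coercive _ (Submodule.starProjection_apply_mem W x)
  rw [h0] at h3
  have h4 : ε * ‖A₀ x‖ ≤ ε * ((M + 1 + L + K) * ‖x‖) := mul_le_mul_of_nonneg_left h2 hε
  rw [div_mul_eq_mul_div, div_mul_eq_mul_div, le_div_iff₀ hκ]
  linarith

variable (he : Orthonormal ℝ e) (heW : ∀ i, e i ∈ Wᗮ) (hφ : ∀ i, φ i - e i ∈ W)

include he heW hφ in
theorem inner_diagOp_apply (i : ι) (x : H) :
    ⟪e i, diagOp ℓ φ x⟫_ℝ = ℓ i * ⟪φ i, x⟫_ℝ := by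
  classical
  have h1 : ∀ j, ⟪e i, φ j⟫_ℝ = if i = j then 1 else 0 := by
    intro j
    have h2 : ⟪e i, φ j - e j⟫_ℝ = 0 := by
      rw [real_inner_comm]
      exact (Submodule.mem_orthogonal _ _).mp (heW i) _ (hφ j)
    rw [inner_sub_right, sub_eq_zero] at h2
    rw [h2, orthonormal_iff_ite.mp he]
  simp [diagOp_apply, inner_sum, inner_smul_right, h1]

include he heW hφ in
theorem abs_sub_mul_inner_le_of_approx_eigenvector [W.HasOrthogonalProjection]
    (h : IsScaleSeparated W κ K ε A₀ R) (hB : ∀ i, |ℓ i| * ‖φ i - e i‖ ≤ B) {c : ℝ}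
    (hx : ‖(A₀ + diagOp ℓ φ + R) x - μ • x‖ ≤ θ * ‖x‖)
    (hx0 : ‖W.starProjection x‖ ≤ c * ε * ‖x‖) (i : ι) :
    |μ - ℓ i| * |⟪e i, x⟫_ℝ| ≤ (θ + (B * c + K) * ε) * ‖x‖ := by
  have hA : ⟪e i, A₀ x⟫_ℝ = 0 := by
    rw [real_inner_comm]
    exact (Submodule.mem_orthogonal _ _).mp (heW i) _ (h.apply_mem x)
  have hr : ⟪φ i, x⟫_ℝ = ⟪e i, x⟫_ℝ + ⟪φ i - e i, W.starProjection x⟫_ℝ := by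
    rw [← Submodule.inner_starProjection_left_eq_right,
      Submodule.starProjection_eq_self_iff.mpr (hφ i), inner_sub_left]
    ring
  have key : (μ - ℓ i) * ⟪e i, x⟫_ℝ = ℓ i * ⟪φ i - e i, W.starProjection x⟫_ℝ + ⟪e i, R x⟫_ℝ
      - ⟪e i, (A₀ + diagOp ℓ φ + R) x - μ • x⟫_ℝ := by
    simp only [add_apply, inner_sub_right, inner_add_right, hA,
      inner_diagOp_apply he heW hφ, inner_smul_right, hr]
    ring
  rw [← abs_mul, key]
  have b1 : |ℓ i * ⟪φ i - e i, W.starProjection x⟫_ℝ| ≤ B * (c * ε * ‖x‖) := by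
    rw [abs_mul]
    calc |ℓ i| * |⟪φ i - e i, W.starProjection x⟫_ℝ|
        ≤ |ℓ i| * (‖φ i - e i‖ * ‖W.starProjection x‖) :=
          mul_le_mul_of_nonneg_left (abs_real_inner_le_norm _ _) (abs_nonneg _)
      _ = (|ℓ i| * ‖φ i - e i‖) * ‖W.starProjection x‖ := by ring
      _ ≤ B * (c * ε * ‖x‖) :=
          mul_le_mul (hB i) hx0 (norm_nonneg _) (le_trans (by positivity) (hB i))
  have b2 : |⟪e i, R x⟫_ℝ| ≤ K * ε * ‖x‖ := by
    refine (abs_real_inner_le_norm _ _).trans ?_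
    rw [he.1 i, one_mul]
    exact R.le_of_opNorm_le h.norm_le x
  have b3 : |⟪e i, (A₀ + diagOp ℓ φ + R) x - μ • x⟫_ℝ| ≤ θ * ‖x‖ := by
    refine (abs_real_inner_le_norm _ _).trans ?_
    rw [he.1 i, one_mul]
    exact hx
  rw [abs_le] at *
  constructor <;> linarith [b1.1, b1.2, b2.1, b2.2, b3.1, b3.2]

include he heW hφ in
theorem norm_remainder_le_of_approx_eigenvector [W.HasOrthogonalProjection]
    (h : IsScaleSeparated W κ K ε A₀ R)
    (hx : ‖(A₀ + diagOp ℓ φ + R) x - μ • x‖ ≤ θ * ‖x‖) :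
    μ * ‖x - W.starProjection x - ∑ i, ⟪e i, x⟫_ℝ • e i‖ ≤ (θ + K * ε) * ‖x‖ := by
  classical
  set y := x - W.starProjection x - ∑ i, ⟪e i, x⟫_ℝ • e i with hy
  have hyW : y ∈ Wᗮ := Submodule.sub_mem _ (Submodule.sub_starProjection_mem_orthogonal x)
    (Submodule.sum_mem _ fun i _ => Submodule.smul_mem _ _ (heW i))
  have hyW' : ∀ w ∈ W, ⟪y, w⟫_ℝ = 0 := fun w hw => by
    rw [real_inner_comm]
    exact (Submodule.mem_orthogonal _ _).mp hyW w hw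
  have hye : ∀ i, ⟪y, e i⟫_ℝ = 0 := by
    intro i
    have : ⟪W.starProjection x, e i⟫_ℝ = 0 :=
      (Submodule.mem_orthogonal _ _).mp (heW i) _ (Submodule.starProjection_apply_mem W x)
    rw [hy, inner_sub_left, inner_sub_left, this, sum_inner]
    simp [inner_smul_left, orthonormal_iff_ite.mp he, real_inner_comm]
  have hyφ : ∀ i, ⟪y, φ i⟫_ℝ = 0 := by
    intro i
    have := hyW' _ (hφ i)
    rwa [inner_sub_right, hye, sub_zero] at this
  have hyx : ⟪y, x⟫_ℝ = ‖y‖ * ‖y‖ := by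
    have hxy : x = y + W.starProjection x + ∑ i, ⟪e i, x⟫_ℝ • e i := by
      rw [hy]; abel
    conv_lhs => rw [hxy]
    rw [inner_add_right, inner_add_right, hyW' _ (Submodule.starProjection_apply_mem W x),
      inner_sum, real_inner_self_eq_norm_mul_norm]
    simp [inner_smul_right, hye]
  have key : μ * (‖y‖ * ‖y‖) = ⟪y, R x⟫_ℝ - ⟪y, (A₀ + diagOp ℓ φ + R) x - μ • x⟫_ℝ := by
    have : ⟪y, diagOp ℓ φ x⟫_ℝ = 0 := by
      simp [diagOp_apply, inner_sum, inner_smul_right, hyφ]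
    simp only [add_apply, inner_sub_right, inner_add_right, this,
      hyW' _ (h.apply_mem x), inner_smul_right, hyx]
    ring
  have b2 : |⟪y, R x⟫_ℝ| ≤ ‖y‖ * (K * ε * ‖x‖) :=
    (abs_real_inner_le_norm _ _).trans
      (mul_le_mul_of_nonneg_left (R.le_of_opNorm_le h.norm_le x) (norm_nonneg _))
  have b3 : |⟪y, (A₀ + diagOp ℓ φ + R) x - μ • x⟫_ℝ| ≤ ‖y‖ * (θ * ‖x‖) :=
    (abs_real_inner_le_norm _ _).trans (mul_le_mul_of_nonneg_left hx (norm_nonneg _))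
  have h4 : (μ * ‖y‖) * ‖y‖ ≤ ((θ + K * ε) * ‖x‖) * ‖y‖ := by
    rw [abs_le] at b2 b3
    linarith [b2.2, b3.1]
  rcases (norm_nonneg y).eq_or_lt with h0 | h0
  · rw [← h0, mul_zero]
    have := (norm_nonneg _).trans hx
    have := (norm_nonneg _).trans (R.le_of_opNorm_le h.norm_le x)
    linarith
  · exact le_of_mul_le_mul_right h4 h0

end Coordinates

/-- Residual of `x` after removing its components along `e i` for `i` in a set `s`. -/
theorem norm_sub_sum_inner_smul_le [W.HasOrthogonalProjection] (he : Orthonormal ℝ e)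
    (s : Finset ι) [DecidableEq ι] (x : H) {a b c : ℝ}
    (ha : ‖W.starProjection x‖ ≤ a) (hb : ∀ i ∉ s, |⟪e i, x⟫_ℝ| ≤ b) (hb0 : 0 ≤ b)
    (hc : ‖x - W.starProjection x - ∑ i, ⟪e i, x⟫_ℝ • e i‖ ≤ c) :
    ‖x - ∑ i ∈ s, ⟪e i, x⟫_ℝ • e i‖ ≤ a + Fintype.card ι * b + c := by
  have h1 : x - ∑ i ∈ s, ⟪e i, x⟫_ℝ • e i = W.starProjection x + ∑ i ∈ sᶜ, ⟪e i, x⟫_ℝ • e i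
      + (x - W.starProjection x - ∑ i, ⟪e i, x⟫_ℝ • e i) := by
    rw [← Finset.sum_add_sum_compl s]
    abel
  have h2 : ‖∑ i ∈ sᶜ, ⟪e i, x⟫_ℝ • e i‖ ≤ Fintype.card ι * b := by
    refine (norm_sum_le _ _).trans ?_
    refine (Finset.sum_le_card_nsmul _ _ b fun i hi => ?_).trans ?_
    · rw [norm_smul, he.1 i, mul_one, Real.norm_eq_abs]
      exact hb i (Finset.mem_compl.mp hi)
    · rw [nsmul_eq_mul]
      gcongr
      exact Finset.card_le_univ _
  rw [h1]
  exact (norm_add₃_le).trans (add_le_add (add_le_add ha h2) hc)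

end Perturbation

section PerturbationBound

open Module.End

variable {H : Type*} [NormedAddCommGroup H] [InnerProductSpace ℝ H] [CompleteSpace H]
variable {ι : Type*} [Fintype ι] {e φ : ι → H} {ℓ : ι → ℝ} {W : Submodule ℝ H}

omit [CompleteSpace H] in
theorem exists_apply_eq_neg_of_coercive [FiniteDimensional ℝ W] {κ K ε : ℝ} (hκ : 0 < κ)
    {A₀ R : H →L[ℝ] H} (h : IsScaleSeparated W κ K ε A₀ R) {g : H} (hg : g ∈ W) :
    ∃ u ∈ W, A₀ u = -g := by
  let f : W →ₗ[ℝ] W := (A₀ : H →ₗ[ℝ] H).restrict fun x _ => h.apply_mem x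
  have hf : Function.Injective f := by
    rw [injective_iff_map_eq_zero]
    intro u hu
    have h1 : A₀ u = 0 := congrArg Subtype.val hu
    have h2 := h.coercive u u.2
    rw [h1, norm_zero, mul_zero] at h2
    have h3 : ‖(u : H)‖ ≤ 0 := by
      by_contra hne
      push Not at hne
      nlinarith
    exact Subtype.ext (norm_le_zero_iff.mp h3)
  obtain ⟨u, hu⟩ := (LinearMap.injective_iff_surjective.mp hf) ⟨-g, W.neg_mem hg⟩
  exact ⟨u, u.2, congrArg Subtype.val hu⟩

omit [CompleteSpace H] in
/-- A vector of the unperturbed eigenspace is close to an approximate eigenvector. -/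
theorem exists_approx_eigenvector (he : Orthonormal ℝ e) (heW : ∀ i, e i ∈ Wᗮ)
    (hφ : ∀ i, φ i - e i ∈ W) [FiniteDimensional ℝ W] {κ K ε L M lam : ℝ} (hκ : 0 < κ)
    (hK : 0 ≤ K) (hε : 0 ≤ ε) (hε1 : ε ≤ 1) (hL : ‖diagOp ℓ φ‖ ≤ L) (hM : |lam| ≤ M)
    {A₀ R : H →L[ℝ] H} (h : IsScaleSeparated W κ K ε A₀ R)
    {v : H} (hv : v ∈ Submodule.span ℝ (e '' {i | ℓ i = lam})) :
    ∃ u, ‖u‖ ≤ ((L + M) / κ) * ε * ‖v‖ ∧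
      ‖(A₀ + diagOp ℓ φ + R) (v + u) - lam • (v + u)‖
        ≤ ((L + M + K) * ((L + M) / κ) + K) * ε * ‖v‖ := by
  classical
  have hvW : A₀ v = 0 := by
    apply h.apply_eq_zero
    refine (Submodule.span_le.mpr ?_) hv
    rintro _ ⟨i, -, rfl⟩
    exact heW i
  have hg : diagOp ℓ φ v - lam • v ∈ W := by
    induction hv using Submodule.span_induction with
    | mem x hx =>
      obtain ⟨i, hi, rfl⟩ := hx
      have h1 : ∀ j, ⟪φ j, e i⟫_ℝ = if j = i then 1 else 0 := by
        intro j
        have h2 := (Submodule.mem_orthogonal _ _).mp (heW i) _ (hφ j)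
        rw [inner_sub_left, sub_eq_zero] at h2
        rw [h2, orthonormal_iff_ite.mp he]
      have : diagOp ℓ φ (e i) - lam • e i = lam • (φ i - e i) := by
        have hi' : ℓ i = lam := hi
        simp [diagOp_apply, h1, hi', smul_sub]
      rw [this]
      exact W.smul_mem _ (hφ i)
    | zero => simp
    | add x y _ _ hx hy =>
      have : diagOp ℓ φ (x + y) - lam • (x + y)
          = (diagOp ℓ φ x - lam • x) + (diagOp ℓ φ y - lam • y) := by
        rw [map_add, smul_add]; abel
      rw [this]
      refine W.add_mem (hx ?_) (hy ?_) <;>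
      · apply h.apply_eq_zero
        refine (Submodule.span_le.mpr ?_) ‹_›
        rintro _ ⟨i, -, rfl⟩
        exact heW i
    | smul a x _ hx =>
      have : diagOp ℓ φ (a • x) - lam • a • x = a • (diagOp ℓ φ x - lam • x) := by
        rw [map_smul, smul_comm, smul_sub]
      rw [this]
      refine W.smul_mem _ (hx ?_)
      apply h.apply_eq_zero
      refine (Submodule.span_le.mpr ?_) ‹_›
      rintro _ ⟨i, -, rfl⟩
      exact heW i
  have hres : ∀ z : H, ‖diagOp ℓ φ z - lam • z‖ ≤ (L + M) * ‖z‖ := by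
    intro z
    have t1 := (diagOp ℓ φ).le_of_opNorm_le hL z
    have t2 : ‖lam • z‖ ≤ M * ‖z‖ := by
      rw [norm_smul, Real.norm_eq_abs]
      exact mul_le_mul_of_nonneg_right hM (norm_nonneg _)
    have := norm_sub_le (diagOp ℓ φ z) (lam • z)
    linarith
  obtain ⟨u, huW, hu⟩ := exists_apply_eq_neg_of_coercive hκ h hg
  have hun : ‖u‖ ≤ ((L + M) / κ) * ε * ‖v‖ := by
    have h1 := h.coercive u huW
    rw [hu, norm_neg] at h1
    have h2 := mul_le_mul_of_nonneg_left (hres v) hε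
    rw [div_mul_eq_mul_div, div_mul_eq_mul_div, le_div_iff₀ hκ]
    linarith
  refine ⟨u, hun, ?_⟩
  have key : (A₀ + diagOp ℓ φ + R) (v + u) - lam • (v + u)
      = (diagOp ℓ φ u - lam • u) + R v + R u := by
    simp only [add_apply, map_add, hu, hvW, smul_add]
    abel
  have hLM : 0 ≤ L + M := add_nonneg ((norm_nonneg _).trans hL) ((abs_nonneg _).trans hM)
  have hRv := R.le_of_opNorm_le h.norm_le v
  have hRu : ‖R u‖ ≤ K * ‖u‖ :=
    (R.le_of_opNorm_le h.norm_le u).trans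
      (mul_le_mul_of_nonneg_right (mul_le_of_le_one_right hK hε1) (norm_nonneg _))
  rw [key]
  refine norm_add₃_le.trans ?_
  have t := mul_le_mul_of_nonneg_left hun (add_nonneg hLM hK)
  have t' := hres u
  nlinarith

theorem exists_pos_le_of_finite {J : Type*} [Finite J] (f : J → ℝ) (hf : ∀ j, 0 < f j) :
    ∃ a, 0 < a ∧ ∀ j, a ≤ f j := by
  rcases isEmpty_or_nonempty J with h | h
  · exact ⟨1, one_pos, fun j => isEmptyElim j⟩
  · obtain ⟨j, hj⟩ := Finite.exists_min f
    exact ⟨f j, hf j, hj⟩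

theorem exists_upper_bound_of_finite {J : Type*} [Finite J] (f : J → ℝ) :
    ∃ a, 0 < a ∧ ∀ j, f j ≤ a := by
  rcases isEmpty_or_nonempty J with h | h
  · exact ⟨1, one_pos, fun j => isEmptyElim j⟩
  · obtain ⟨j, hj⟩ := Finite.exists_max f
    exact ⟨max (f j) 1, by positivity, fun i => (hj i).trans (le_max_left _ _)⟩

omit [CompleteSpace H] in
/-- Any real eigenvalue of the perturbed operator near `lam` is within `O(ε)` of `lam`. -/
theorem abs_sub_le_of_hasEigenvalue (he : Orthonormal ℝ e) (heW : ∀ i, e i ∈ Wᗮ)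
    (hφ : ∀ i, φ i - e i ∈ W) [FiniteDimensional ℝ W] {κ K ε L M B a δ c₁ c₂ lam μ : ℝ}
    (hκ : 0 < κ) (hK : 0 ≤ K) (hε : 0 ≤ ε) (hε1 : ε ≤ 1) (hL : ‖diagOp ℓ φ‖ ≤ L)
    (hB : ∀ i, |ℓ i| * ‖φ i - e i‖ ≤ B) (ha : 0 < a) (hδ : 0 < δ)
    (hgap : ∀ i, ℓ i ≠ lam → 2 * δ ≤ |lam - ℓ i|)
    (haμ : a ≤ μ) (hμM : μ ≤ M) (hc₁ : c₁ = (M + 1 + L + K) / κ)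
    (hc₂ : c₂ = B * c₁ + K) (hc₂0 : 0 ≤ c₂) (h1 : c₁ * ε ≤ 1 / 4)
    (h2 : c₂ * ε ≤ δ / (4 * (Fintype.card ι + 1))) (h3 : K * ε ≤ a / 4)
    {A₀ R : H →L[ℝ] H} (h : IsScaleSeparated W κ K ε A₀ R)
    (hμ : HasEigenvalue ((A₀ + diagOp ℓ φ + R : H →L[ℝ] H) : H →ₗ[ℝ] H) μ)
    (hμδ : |μ - lam| ≤ δ) : |μ - lam| ≤ 4 * (Fintype.card ι + 1) * c₂ * ε := by
  classical
  by_contra! hcon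
  obtain ⟨x, hx⟩ := hμ.exists_hasEigenvector
  have hx0 : 0 < ‖x‖ := norm_pos_iff.mpr hx.2
  have hTx : (A₀ + diagOp ℓ φ + R) x = μ • x := hx.apply_eq_smul
  have hres : ‖(A₀ + diagOp ℓ φ + R) x - μ • x‖ ≤ 0 * ‖x‖ := by simp [hTx]
  have n0 : (0 : ℝ) < 4 * (Fintype.card ι + 1) := by positivity
  have e0 := norm_starProjection_le_of_approx_eigenvector (M := M) h hκ hK hε hε1 hL
    (by rw [abs_of_pos (ha.trans_le haμ)]; exact hμM) zero_le_one hres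
  rw [← hc₁] at e0
  have e1 := abs_sub_mul_inner_le_of_approx_eigenvector he heW hφ h hB hres e0
  rw [← hc₂, zero_add] at e1
  have e2 := norm_remainder_le_of_approx_eigenvector he heW hφ h hres
  rw [zero_add] at e2
  have f1 : ∀ i, |⟪e i, x⟫_ℝ| ≤ ‖x‖ / (4 * (Fintype.card ι + 1)) := by
    intro i
    by_cases hi : ℓ i = lam
    · by_contra! hlt
      have hp : 4 * (Fintype.card ι + 1) * c₂ * ε * (‖x‖ / (4 * (Fintype.card ι + 1)))
          < |μ - lam| * |⟪e i, x⟫_ℝ| :=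
        mul_lt_mul'' hcon hlt (by positivity) (by positivity)
      have hq := e1 i
      rw [hi] at hq
      have : 4 * (Fintype.card ι + 1) * c₂ * ε * (‖x‖ / (4 * (Fintype.card ι + 1)))
          = c₂ * ε * ‖x‖ := by field_simp
      linarith
    · have hd : δ ≤ |μ - ℓ i| := by
        have := hgap i hi
        have t := abs_sub_le lam μ (ℓ i)
        rw [abs_sub_comm lam μ] at t
        linarith
      have hq : δ * |⟪e i, x⟫_ℝ| ≤ δ * (‖x‖ / (4 * (Fintype.card ι + 1))) := by
        calc δ * |⟪e i, x⟫_ℝ| ≤ |μ - ℓ i| * |⟪e i, x⟫_ℝ| := by gcongr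
          _ ≤ c₂ * ε * ‖x‖ := e1 i
          _ ≤ δ / (4 * (Fintype.card ι + 1)) * ‖x‖ := by gcongr
          _ = _ := by ring
      exact le_of_mul_le_mul_left hq hδ
  have f2 : ‖x - W.starProjection x - ∑ i, ⟪e i, x⟫_ℝ • e i‖ ≤ ‖x‖ / 4 := by
    have t : a * ‖x - W.starProjection x - ∑ i, ⟪e i, x⟫_ℝ • e i‖ ≤ a * (‖x‖ / 4) := by
      calc _ ≤ μ * ‖x - W.starProjection x - ∑ i, ⟪e i, x⟫_ℝ • e i‖ := by gcongr
        _ ≤ K * ε * ‖x‖ := e2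
        _ ≤ a / 4 * ‖x‖ := by gcongr
        _ = _ := by ring
    exact le_of_mul_le_mul_left t ha
  have f0 : ‖W.starProjection x‖ ≤ ‖x‖ / 4 := by
    calc _ ≤ c₁ * ε * ‖x‖ := e0
      _ ≤ 1 / 4 * ‖x‖ := by gcongr
      _ = _ := by ring
  have tot := norm_sub_sum_inner_smul_le he ∅ x f0 (fun i _ => f1 i) (by positivity) f2
  simp only [Finset.sum_empty, sub_zero] at tot
  have : (Fintype.card ι : ℝ) * (‖x‖ / (4 * (Fintype.card ι + 1))) ≤ ‖x‖ / 4 := by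
    rw [mul_div_assoc', div_le_div_iff₀ n0 (by norm_num)]
    nlinarith
  linarith

set_option maxHeartbeats 1000000 in
/-- Spectral perturbation bound for `A₀ + ∑ ℓᵢ φᵢ ⊗ φᵢ + R`: here `φᵢ` is an orthonormal
family up to vectors of `W`, the operator `A₀` is of size at least `ε⁻¹` on `W`, and `R` is of
size at most `ε`. -/
theorem exists_perturbation_bounds (he : Orthonormal ℝ e) (heW : ∀ i, e i ∈ Wᗮ)
    (hφ : ∀ i, φ i - e i ∈ W) [FiniteDimensional ℝ W] (hℓ : ∀ i, 0 < ℓ i) {κ K : ℝ}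
    (hκ : 0 < κ) (hK : 0 ≤ K) :
    ∃ C D ε₀ : ℝ, 0 < C ∧ 0 < D ∧ 0 < ε₀ ∧
      ∀ ε : ℝ, ε ∈ Set.Icc 0 ε₀ → ∀ A₀ R : H →L[ℝ] H, IsScaleSeparated W κ K ε A₀ R →
        IsCompactOperator (A₀ + diagOp ℓ φ + R) →
        ((A₀ + diagOp ℓ φ + R : H →L[ℝ] H) : H →ₗ[ℝ] H).IsSymmetric → ∀ i₀ : ι,
          Module.finrank ℝ (eigSpan (A₀ + diagOp ℓ φ + R)
              (Set.Icc (ℓ i₀ * (1 - C * ε)) (ℓ i₀ * (1 + C * ε))))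
            = Module.finrank ℝ (Submodule.span ℝ (e '' {i | ℓ i = ℓ i₀})) ∧
          ∃ P Q : H →L[ℝ] H, IsOrthoProj P (Submodule.span ℝ (e '' {i | ℓ i = ℓ i₀})) ∧
            IsOrthoProj Q (eigSpan (A₀ + diagOp ℓ φ + R)
              (Set.Icc (ℓ i₀ * (1 - C * ε)) (ℓ i₀ * (1 + C * ε)))) ∧
            ‖P - Q‖ ≤ D * ε := by
  classical
  obtain ⟨a, ha, haℓ⟩ := exists_pos_le_of_finite ℓ hℓ
  obtain ⟨Lm, hLm, hLmℓ⟩ := exists_upper_bound_of_finite ℓ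
  obtain ⟨B, hB0, hB⟩ := exists_upper_bound_of_finite fun i => |ℓ i| * ‖φ i - e i‖
  obtain ⟨g, hg, hgℓ⟩ := exists_pos_le_of_finite
    (fun p : {p : ι × ι // ℓ p.1 ≠ ℓ p.2} => |ℓ p.1.1 - ℓ p.1.2|)
    (fun p => abs_pos.mpr (sub_ne_zero.mpr p.2))
  obtain ⟨δ, hδ, hδg, hδa, hδ1⟩ : ∃ δ : ℝ, 0 < δ ∧ 2 * δ ≤ g ∧ δ ≤ a / 2 ∧ δ ≤ 1 :=
    ⟨min (g / 2) (min (a / 2) 1), by positivity,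
      by linarith [min_le_left (g / 2) (min (a / 2) 1)],
      (min_le_right _ _).trans (min_le_left _ _), (min_le_right _ _).trans (min_le_right _ _)⟩
  set n : ℝ := ((Fintype.card ι : ℕ) : ℝ) with hn
  have hn0 : 0 ≤ n := by positivity
  set L := ‖diagOp ℓ φ‖ with hLdef
  have hL0 : 0 ≤ L := norm_nonneg _
  set M := Lm + 1 with hM
  set c₁ := (M + 1 + L + K) / κ with hc₁
  have hc₁0 : 0 < c₁ := by positivity
  set c₂ := B * c₁ + K with hc₂
  have hc₂0 : 0 < c₂ := by positivity
  set C := 4 * (n + 1) * c₂ / a with hC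
  have hC0 : 0 < C := by positivity
  set D₁ := c₁ + n * ((Lm * C + c₂) / (2 * δ)) + (Lm * C + K) / a with hD₁
  have hD₁0 : 0 < D₁ := by positivity
  set c₄ := (L + M) / κ with hc₄
  have hc₄0 : 0 < c₄ := by positivity
  set D₂ := ((L + M + K) * c₄ + K) / δ + c₄ with hD₂
  have hD₂0 : 0 < D₂ := by positivity
  obtain ⟨ε₀, hε₀, q1, q2, q3, q4, q5, q6⟩ : ∃ ε₀ : ℝ, 0 < ε₀ ∧ ε₀ ≤ 1 ∧ c₁ * ε₀ ≤ 1 / 4 ∧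
      c₂ * ε₀ ≤ δ / (4 * (n + 1)) ∧ K * ε₀ ≤ a / 8 ∧ Lm * C * ε₀ ≤ δ ∧
      (D₁ + D₂) * ε₀ ≤ 1 / 2 := by
    have hev : ∀ s t : ℝ, 0 < t → ∀ᶠ r in nhdsWithin (0 : ℝ) (Set.Ioi 0), s * r ≤ t := by
      intro s t ht
      have hc : Filter.Tendsto (fun r : ℝ => s * r) (nhdsWithin 0 (Set.Ioi 0)) (nhds (s * 0)) :=
        ((continuous_const.mul continuous_id).tendsto 0).mono_left nhdsWithin_le_nhds
      rw [mul_zero] at hc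
      exact (hc.eventually_lt_const ht).mono fun _ => le_of_lt
    have := (eventually_nhdsWithin_of_forall (fun x (hx : x ∈ Set.Ioi (0 : ℝ)) => hx)).and
      ((hev 1 1 one_pos).and ((hev c₁ (1 / 4) (by norm_num)).and
      ((hev c₂ (δ / (4 * (n + 1))) (by positivity)).and ((hev K (a / 8) (by positivity)).and
      ((hev (Lm * C) δ hδ).and (hev (D₁ + D₂) (1 / 2) (by norm_num)))))))
    obtain ⟨r, h0, h1, h2⟩ := this.exists
    exact ⟨r, h0, by simpa using h1, h2⟩
  refine ⟨C, D₁ + D₂, ε₀, hC0, by positivity, hε₀, ?_⟩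
  rintro ε ⟨hε, hεε⟩ A₀ R h hcpt hsymm i₀
  have hmono : ∀ s : ℝ, 0 ≤ s → s * ε ≤ s * ε₀ := fun s hs => mul_le_mul_of_nonneg_left hεε hs
  have hε1 : ε ≤ 1 := hεε.trans q1
  have p1 := (hmono c₁ hc₁0.le).trans q2
  have p2 := (hmono c₂ hc₂0.le).trans q3
  have p3 := (hmono K hK).trans q4
  have p4 := (hmono (Lm * C) (by positivity)).trans q5
  have p5 := (hmono (D₁ + D₂) (by positivity)).trans q6
  set lam := ℓ i₀ with hlam
  have hlam0 : 0 < lam := hℓ i₀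
  have halam : a ≤ lam := haℓ i₀
  have hlamL : lam ≤ Lm := hLmℓ i₀
  have hgap : ∀ i, ℓ i ≠ lam → 2 * δ ≤ |lam - ℓ i| := fun i hi =>
    hδg.trans (hgℓ ⟨(i₀, i), hi.symm⟩)
  set T := A₀ + diagOp ℓ φ + R with hT
  set s := Set.Icc (lam * (1 - C * ε)) (lam * (1 + C * ε)) with hs
  have hmem : ∀ μ, μ ∈ s ↔ |μ - lam| ≤ lam * C * ε := by
    intro μ
    rw [hs, Set.mem_Icc, abs_le]
    constructor <;> rintro ⟨h1, h2⟩ <;> constructor <;> linarith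
  have hlamC : lam * C * ε ≤ Lm * C * ε := by gcongr
  have hsδ : ∀ μ ∉ s, HasEigenvalue (T : H →ₗ[ℝ] H) μ → δ ≤ |μ - lam| := by
    intro μ hμs hμ
    by_contra! hlt
    apply hμs
    rw [hmem]
    have hb := abs_lt.mp hlt
    have := abs_sub_le_of_hasEigenvalue (a := a / 2) (M := M) (c₁ := c₁) (c₂ := c₂) he heW hφ
      hκ hK hε hε1 le_rfl hB (by positivity) hδ hgap
      (by linarith) (by linarith) hc₁ hc₂ hc₂0.le p1 p2 (by linarith) h hμ hlt.le
    refine this.trans ?_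
    have hCa : 4 * (n + 1) * c₂ = a * C := by rw [hC]; field_simp
    rw [← hn, hCa]
    gcongr
  set V := Submodule.span ℝ (e '' {i | ℓ i = lam}) with hV
  have : FiniteDimensional ℝ V := FiniteDimensional.span_of_finite ℝ (Set.toFinite _)
  set E := eigSpan T s with hE
  have hEV : ∀ x ∈ E, ‖x - V.starProjection x‖ ≤ (D₁ * ε) * ‖x‖ := by
    intro x hx
    have hres : ‖T x - lam • x‖ ≤ (Lm * C * ε) * ‖x‖ :=
      norm_apply_sub_smul_le_of_mem_eigSpan hcpt hsymm (by positivity)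
        (fun μ hμ => ((hmem μ).mp hμ).trans hlamC) hx
    have e0 := norm_starProjection_le_of_approx_eigenvector (M := M) h hκ hK hε hε1 hLdef.ge
      (by rw [abs_of_pos hlam0]; linarith) (p4.trans hδ1) hres
    rw [← hc₁] at e0
    have e1 := abs_sub_mul_inner_le_of_approx_eigenvector he heW hφ h hB hres e0
    rw [← hc₂] at e1
    have e2 := norm_remainder_le_of_approx_eigenvector he heW hφ h hres
    have f1 : ∀ i ∉ Finset.univ.filter (fun i => ℓ i = lam),
        |⟪e i, x⟫_ℝ| ≤ (Lm * C + c₂) / (2 * δ) * ε * ‖x‖ := by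
      intro i hi
      have hi' : ℓ i ≠ lam := by simpa using hi
      have t : 2 * δ * |⟪e i, x⟫_ℝ| ≤ (Lm * C * ε + c₂ * ε) * ‖x‖ :=
        (mul_le_mul_of_nonneg_right (hgap i hi') (abs_nonneg _)).trans (e1 i)
      have : (Lm * C + c₂) / (2 * δ) * ε * ‖x‖
          = ((Lm * C * ε + c₂ * ε) * ‖x‖) / (2 * δ) := by ring
      rw [this, le_div_iff₀ (by positivity)]
      linarith
    have f2 : ‖x - W.starProjection x - ∑ i, ⟪e i, x⟫_ℝ • e i‖ ≤ (Lm * C + K) / a * ε * ‖x‖ := by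
      have t := (mul_le_mul_of_nonneg_right halam (norm_nonneg
        (x - W.starProjection x - ∑ i, ⟪e i, x⟫_ℝ • e i))).trans e2
      have : (Lm * C + K) / a * ε * ‖x‖ = ((Lm * C * ε + K * ε) * ‖x‖) / a := by ring
      rw [this, le_div_iff₀ ha]
      linarith
    have tot := norm_sub_sum_inner_smul_le he (Finset.univ.filter fun i => ℓ i = lam) x e0 f1
      (by positivity) f2
    have hmin : ‖x - V.starProjection x‖
        ≤ ‖x - ∑ i ∈ Finset.univ.filter (fun i => ℓ i = lam), ⟪e i, x⟫_ℝ • e i‖ := by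
      have hw : ∑ i ∈ Finset.univ.filter (fun i => ℓ i = lam), ⟪e i, x⟫_ℝ • e i ∈ V :=
        Submodule.sum_mem _ fun i hi => Submodule.smul_mem _ _
          (Submodule.subset_span ⟨i, by simpa using hi, rfl⟩)
      rw [Submodule.starProjection_minimal]
      exact ciInf_le ⟨0, by rintro _ ⟨w, rfl⟩; exact norm_nonneg _⟩
        (⟨∑ i ∈ Finset.univ.filter (fun i => ℓ i = lam), ⟪e i, x⟫_ℝ • e i, hw⟩ : V)
    refine hmin.trans (tot.trans (le_of_eq ?_))
    rw [hD₁, ← hn]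
    ring
  have hd1 : D₁ * ε < 1 := by nlinarith
  have hd2 : D₂ * ε < 1 := by nlinarith
  have hinjE := injective_starProjection_of_norm_sub_le hd1 hEV
  have : FiniteDimensional ℝ E := FiniteDimensional.of_injective _ hinjE
  have hVE : ∀ v ∈ V, ‖v - E.starProjection v‖ ≤ (D₂ * ε) * ‖v‖ := by
    intro v hv
    obtain ⟨u, hu, hw⟩ := exists_approx_eigenvector (M := M) he heW hφ hκ hK hε hε1 hLdef.ge
      (by rw [abs_of_pos hlam0]; linarith) h hv
    rw [← hc₄] at hu hw
    have h1 := norm_sub_starProjection_eigSpan_le hcpt hsymm hδ.le hsδ (v + u)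
    have h2 : ‖u - E.starProjection u‖ ≤ ‖u‖ := by
      rw [← Submodule.starProjection_orthogonal_val]
      exact Submodule.norm_starProjection_apply_le _ _
    have h3 : v - E.starProjection v
        = ((v + u) - E.starProjection (v + u)) - (u - E.starProjection u) := by
      rw [map_add]; abel
    have h4 : ‖(v + u) - E.starProjection (v + u)‖
        ≤ ((L + M + K) * c₄ + K) / δ * ε * ‖v‖ := by
      have : ((L + M + K) * c₄ + K) / δ * ε * ‖v‖
          = (((L + M + K) * c₄ + K) * ε * ‖v‖) / δ := by ring
      rw [this, le_div_iff₀ hδ, mul_comm]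
      exact h1.trans hw
    rw [h3]
    refine (norm_sub_le _ _).trans ?_
    rw [hD₂]
    linarith
  have hinjV := injective_starProjection_of_norm_sub_le hd2 hVE
  refine ⟨le_antisymm (LinearMap.finrank_le_finrank_of_injective hinjE)
    (LinearMap.finrank_le_finrank_of_injective hinjV), V.starProjection, E.starProjection,
    isOrthoProj_starProjection V, isOrthoProj_starProjection E, ?_⟩
  have := norm_starProjection_sub_starProjection_le (a := D₁ * ε) (b := D₂ * ε)
    (by positivity) (by positivity) hEV hVE
  linarith

end PerturbationBound

section StandardGaussian

open ProbabilityTheory Polynomial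

theorem integrable_pow_gaussianReal (n : ℕ) :
    Integrable (fun x : ℝ => x ^ n) (gaussianReal 0 1) := by
  have h := (memLp_id_gaussianReal (μ := 0) (v := 1) (n : NNReal)).integrable_norm_pow'
  refine h.mono' (by fun_prop) (Filter.Eventually.of_forall fun x => ?_)
  simp

theorem integrable_eval_gaussianReal (p : ℝ[X]) :
    Integrable (fun x : ℝ => p.eval x) (gaussianReal 0 1) := by
  simp only [Polynomial.eval_eq_sum_range]
  exact integrable_finsetSum _ fun i _ => (integrable_pow_gaussianReal i).const_mul _

/-- Stein's identity for polynomials. -/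
theorem integral_mul_eval_gaussianReal (p : ℝ[X]) :
    ∫ x, x * p.eval x ∂(gaussianReal 0 1) = ∫ x, p.derivative.eval x ∂(gaussianReal 0 1) := by
  have hd : ∀ x, HasDerivAt (gaussianPDFReal 0 1) (-x * gaussianPDFReal 0 1 x) x := by
    intro x
    have h1 : HasDerivAt (fun y : ℝ => -(y - 0) ^ 2 / (2 * ((1 : NNReal) : ℝ))) (-x) x := by
      have := (((hasDerivAt_id x).sub_const 0).pow 2).neg.div_const (2 * ((1 : NNReal) : ℝ))
      refine this.congr_deriv ?_
      simp
      ring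
    have h2 := (h1.exp).const_mul (√(2 * Real.pi * ((1 : NNReal) : ℝ)))⁻¹
    rw [gaussianPDFReal_def]
    refine h2.congr_deriv ?_
    ring
  have hint : ∀ q : ℝ[X], Integrable fun x => gaussianPDFReal 0 1 x * q.eval x := by
    intro q
    have h := integrable_eval_gaussianReal q
    rw [gaussianReal_of_var_ne_zero _ one_ne_zero,
      integrable_withDensity_iff_integrable_smul' (measurable_gaussianPDF _ _)
        (Filter.Eventually.of_forall fun x => by simp [gaussianPDF])] at h
    refine h.congr (Filter.Eventually.of_forall fun x => ?_)
    simp [gaussianPDF, ENNReal.toReal_ofReal (gaussianPDFReal_nonneg 0 1 x)]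
  have h0 := integral_eq_zero_of_hasDerivAt_of_integrable
    (f := fun x => gaussianPDFReal 0 1 x * p.eval x)
    (f' := fun x => gaussianPDFReal 0 1 x * (p.derivative - X * p).eval x)
    (fun x => ((hd x).mul (p.hasDerivAt x)).congr_deriv (by simp; ring)) (hint _) (hint p)
  have h1 : ∫ x, (p.derivative - X * p).eval x ∂(gaussianReal 0 1) = 0 := by
    rw [integral_gaussianReal_eq_integral_smul one_ne_zero]
    simpa using h0
  have h2 : ∀ x : ℝ, (p.derivative - X * p).eval x = p.derivative.eval x - (X * p).eval x :=
    fun x => by simp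
  simp_rw [h2] at h1
  rw [integral_sub (integrable_eval_gaussianReal _) (integrable_eval_gaussianReal _),
    sub_eq_zero] at h1
  rw [h1]
  simp

/-- The Hermite polynomial with real coefficients. -/
noncomputable def hermiteReal (n : ℕ) : ℝ[X] := (hermite n).map (Int.castRingHom ℝ)

theorem eval_hermiteReal (n : ℕ) (x : ℝ) : (hermiteReal n).eval x = He n x := by
  rw [hermiteReal, He, Polynomial.eval_map, Polynomial.aeval_def]
  rfl

theorem monic_hermiteReal (n : ℕ) : (hermiteReal n).Monic := (hermite_monic n).map _

theorem natDegree_hermiteReal (n : ℕ) : (hermiteReal n).natDegree = n := by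
  rw [hermiteReal, (hermite_monic n).natDegree_map, natDegree_hermite]

theorem integral_hermiteReal_succ_mul (n : ℕ) (q : ℝ[X]) :
    ∫ x, (hermiteReal (n + 1) * q).eval x ∂(gaussianReal 0 1)
      = ∫ x, (hermiteReal n * q.derivative).eval x ∂(gaussianReal 0 1) := by
  have h := integral_mul_eval_gaussianReal (hermiteReal n * q)
  have e1 : hermiteReal (n + 1) * q
      = X * (hermiteReal n * q) - (hermiteReal n).derivative * q := by
    simp only [hermiteReal, hermite_succ, Polynomial.map_sub, Polynomial.map_mul, map_X,
      derivative_map]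
    ring
  have e2 : ∀ x : ℝ, (hermiteReal (n + 1) * q).eval x
      = (X * (hermiteReal n * q)).eval x - ((hermiteReal n).derivative * q).eval x :=
    fun x => by rw [e1, eval_sub]
  have e3 : ∀ x : ℝ, (derivative (hermiteReal n * q)).eval x
      = ((hermiteReal n).derivative * q).eval x + (hermiteReal n * q.derivative).eval x :=
    fun x => by rw [derivative_mul, eval_add]
  simp_rw [e2]
  rw [integral_sub (integrable_eval_gaussianReal _) (integrable_eval_gaussianReal _)]
  simp_rw [e3] at h
  rw [integral_add (integrable_eval_gaussianReal _) (integrable_eval_gaussianReal _)] at h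
  have e4 : ∀ x : ℝ, (X * (hermiteReal n * q)).eval x = x * (hermiteReal n * q).eval x :=
    fun x => by simp
  simp_rw [e4]
  rw [h]
  ring

theorem integral_hermiteReal_mul (n : ℕ) (q : ℝ[X]) (hq : q.natDegree ≤ n) :
    ∫ x, (hermiteReal n * q).eval x ∂(gaussianReal 0 1) = n.factorial * q.coeff n := by
  induction n generalizing q with
  | zero =>
    rw [Polynomial.eq_C_of_natDegree_le_zero hq]
    simp [hermiteReal]
  | succ n ih =>
    rw [integral_hermiteReal_succ_mul, ih _ ((natDegree_derivative_le q).trans (by omega)),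
      coeff_derivative, Nat.factorial_succ]
    push_cast
    ring

theorem integral_pow_two_mul_gaussianReal_le (k : ℕ) :
    ∫ x : ℝ, x ^ (2 * k) ∂(gaussianReal 0 1) ≤ 2 ^ k * k.factorial := by
  induction k with
  | zero => simp
  | succ k ih =>
    have h := integral_mul_eval_gaussianReal (X ^ (2 * k + 1))
    have e : ∀ x : ℝ, x * (X ^ (2 * k + 1) : ℝ[X]).eval x = x ^ (2 * (k + 1)) := fun x => by
      simp; ring
    have e' : ∀ x : ℝ, (derivative (X ^ (2 * k + 1) : ℝ[X])).eval x = (2 * k + 1) * x ^ (2 * k) :=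
      fun x => by simp
    simp_rw [e, e'] at h
    rw [h, integral_const_mul, Nat.factorial_succ]
    have h0 : (0 : ℝ) ≤ ∫ x : ℝ, x ^ (2 * k) ∂(gaussianReal 0 1) :=
      integral_nonneg fun x => by simp only [pow_mul]; positivity
    push_cast
    calc (2 * (k : ℝ) + 1) * ∫ x : ℝ, x ^ (2 * k) ∂(gaussianReal 0 1)
        ≤ (2 * (k + 1)) * (2 ^ k * k.factorial) := by gcongr; linarith
      _ = _ := by ring

end StandardGaussian

section GaussianPolynomials

open ProbabilityTheory

/-- The standard Gaussian measure on `ℝ^d`. -/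
noncomputable abbrev stdGaussianPi (d : ℕ) : Measure (Fin d → ℝ) :=
  Measure.pi fun _ : Fin d => gaussianReal 0 1

variable {d : ℕ}

theorem integrable_eval_stdGaussianPi (p : MvPolynomial (Fin d) ℝ) :
    Integrable (fun z => MvPolynomial.eval z p) (stdGaussianPi d) := by
  simp only [MvPolynomial.eval_eq]
  refine integrable_finsetSum _ fun κ _ => Integrable.const_mul ?_ _
  have h : ∀ z : Fin d → ℝ, ∏ i ∈ κ.support, z i ^ κ i = ∏ i, z i ^ κ i := fun z =>
    Finset.prod_subset (Finset.subset_univ _) fun i _ hi => by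
      simp [Finsupp.notMem_support_iff.mp hi]
  simp only [h]
  exact Integrable.fintype_prod (f := fun i x => x ^ κ i) fun i => integrable_pow_gaussianReal _

variable {Ω : Type*} [MeasurableSpace Ω] {μ : Measure Ω} {Z : Ω → Fin d → ℝ}

theorem integrable_eval_comp (hZ : MeasurePreserving Z μ (stdGaussianPi d))
    (p : MvPolynomial (Fin d) ℝ) : Integrable (fun ω => MvPolynomial.eval (Z ω) p) μ :=
  hZ.integrable_comp_of_integrable (integrable_eval_stdGaussianPi p)

theorem integral_eval_comp (hZ : MeasurePreserving Z μ (stdGaussianPi d))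
    (p : MvPolynomial (Fin d) ℝ) :
    ∫ ω, MvPolynomial.eval (Z ω) p ∂μ = ∫ z, MvPolynomial.eval z p ∂(stdGaussianPi d) := by
  rw [← hZ.map_eq, integral_map hZ.aemeasurable]
  exact (MvPolynomial.continuous_eval p).aestronglyMeasurable

theorem memLp_eval_comp (hZ : MeasurePreserving Z μ (stdGaussianPi d))
    (p : MvPolynomial (Fin d) ℝ) : MemLp (fun ω => MvPolynomial.eval (Z ω) p) 2 μ := by
  rw [memLp_two_iff_integrable_sq (integrable_eval_comp hZ p).aestronglyMeasurable]
  exact (integrable_eval_comp hZ (p ^ 2)).congr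
    (Filter.Eventually.of_forall fun ω => map_pow (MvPolynomial.eval (Z ω)) p 2)

/-- A polynomial in the Gaussian vector `Z`, as an element of `L²`. -/
noncomputable def polyLp (hZ : MeasurePreserving Z μ (stdGaussianPi d)) :
    MvPolynomial (Fin d) ℝ →ₗ[ℝ] Lp ℝ 2 μ where
  toFun p := (memLp_eval_comp hZ p).toLp _
  map_add' p q := by
    rw [← MemLp.toLp_add, MemLp.toLp_eq_toLp_iff]
    exact Filter.Eventually.of_forall fun ω => by simp
  map_smul' c p := by
    rw [RingHom.id_apply, ← MemLp.toLp_const_smul, MemLp.toLp_eq_toLp_iff]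
    exact Filter.Eventually.of_forall fun ω => by simp

theorem coeFn_polyLp (hZ : MeasurePreserving Z μ (stdGaussianPi d))
    (p : MvPolynomial (Fin d) ℝ) :
    (polyLp hZ p : Ω → ℝ) =ᵐ[μ] fun ω => MvPolynomial.eval (Z ω) p :=
  (memLp_eval_comp hZ p).coeFn_toLp

theorem inner_polyLp (hZ : MeasurePreserving Z μ (stdGaussianPi d))
    (p : MvPolynomial (Fin d) ℝ) (f : Lp ℝ 2 μ) :
    ⟪polyLp hZ p, f⟫_ℝ = ∫ ω, MvPolynomial.eval (Z ω) p * f ω ∂μ := by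
  rw [L2.inner_def]
  refine integral_congr_ae ?_
  filter_upwards [coeFn_polyLp hZ p] with ω h
  rw [h]
  simp [mul_comm]

theorem inner_polyLp_polyLp (hZ : MeasurePreserving Z μ (stdGaussianPi d))
    (p q : MvPolynomial (Fin d) ℝ) :
    ⟪polyLp hZ p, polyLp hZ q⟫_ℝ = ∫ z, MvPolynomial.eval z (p * q) ∂(stdGaussianPi d) := by
  rw [inner_polyLp, ← integral_eval_comp hZ]
  refine integral_congr_ae ?_
  filter_upwards [coeFn_polyLp hZ q] with ω h
  rw [h, map_mul]

/-- The product `∏ᵢ pᵢ(zᵢ)` of univariate polynomials in the different variables. -/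
noncomputable def separated (p : Fin d → Polynomial ℝ) : MvPolynomial (Fin d) ℝ :=
  ∏ i, Polynomial.aeval (MvPolynomial.X i) (p i)

theorem eval_separated (p : Fin d → Polynomial ℝ) (z : Fin d → ℝ) :
    MvPolynomial.eval z (separated p) = ∏ i, (p i).eval (z i) := by
  rw [separated, map_prod]
  refine Finset.prod_congr rfl fun i _ => ?_
  rw [Polynomial.aeval_def, Polynomial.hom_eval₂]
  have h : (MvPolynomial.eval z).comp (algebraMap ℝ (MvPolynomial (Fin d) ℝ)) = RingHom.id ℝ := by
    ext x
    simp
  rw [h, MvPolynomial.eval_X, Polynomial.eval₂_id]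

theorem inner_separated (hZ : MeasurePreserving Z μ (stdGaussianPi d))
    (p q : Fin d → Polynomial ℝ) :
    ⟪polyLp hZ (separated p), polyLp hZ (separated q)⟫_ℝ
      = ∏ i, ∫ x, (p i * q i).eval x ∂(gaussianReal 0 1) := by
  rw [inner_polyLp_polyLp, ← integral_fintype_prod_eq_prod]
  simp only [map_mul, eval_separated, ← Finset.prod_mul_distrib, Polynomial.eval_mul]

/-- The normalized Hermite polynomial of multidegree `β`. -/
noncomputable def hermPoly (β : Fin d → ℕ) : MvPolynomial (Fin d) ℝ :=
  separated fun i => Polynomial.C (√((β i).factorial : ℝ))⁻¹ * hermiteReal (β i)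

/-- The normalized monomial `z^β / √β!`. -/
noncomputable def monoPoly (β : Fin d → ℕ) : MvPolynomial (Fin d) ℝ :=
  separated fun i => Polynomial.C (√((β i).factorial : ℝ))⁻¹ * Polynomial.X ^ (β i)

theorem eval_hermPoly (β : Fin d → ℕ) (z : Fin d → ℝ) :
    MvPolynomial.eval z (hermPoly β) = ∏ i, hermN (β i) (z i) := by
  rw [hermPoly, eval_separated]
  refine Finset.prod_congr rfl fun i _ => ?_
  rw [Polynomial.eval_mul, Polynomial.eval_C, eval_hermiteReal, hermN, div_eq_inv_mul]

theorem eval_monoPoly (β : Fin d → ℕ) (z : Fin d → ℝ) :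
    MvPolynomial.eval z (monoPoly β) = ∏ i, ((√((β i).factorial : ℝ))⁻¹ * z i ^ β i) := by
  rw [monoPoly, eval_separated]
  simp

theorem integral_C_mul_mul_C_mul (a b : ℝ) (p q : Polynomial ℝ) :
    ∫ x, ((Polynomial.C a * p) * (Polynomial.C b * q)).eval x ∂(gaussianReal 0 1)
      = a * b * ∫ x, (p * q).eval x ∂(gaussianReal 0 1) := by
  rw [← integral_const_mul]
  congr 1
  ext x
  simp
  ring

theorem integral_hermiteReal_mul_hermiteReal (m n : ℕ) :
    ∫ x, (hermiteReal m * hermiteReal n).eval x ∂(gaussianReal 0 1)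
      = if m = n then (n.factorial : ℝ) else 0 := by
  rcases lt_trichotomy m n with h | rfl | h
  · rw [if_neg h.ne, mul_comm, integral_hermiteReal_mul _ _ (by rw [natDegree_hermiteReal]; omega),
      Polynomial.coeff_eq_zero_of_natDegree_lt (by rwa [natDegree_hermiteReal]), mul_zero]
  · rw [if_pos rfl, integral_hermiteReal_mul _ _ (natDegree_hermiteReal m).le]
    have := (monic_hermiteReal m).coeff_natDegree
    rw [natDegree_hermiteReal] at this
    rw [this, mul_one]
  · rw [if_neg h.ne', integral_hermiteReal_mul _ _ (by rw [natDegree_hermiteReal]; omega),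
      Polynomial.coeff_eq_zero_of_natDegree_lt (by rwa [natDegree_hermiteReal]), mul_zero]

theorem orthonormal_polyLp_hermPoly (hZ : MeasurePreserving Z μ (stdGaussianPi d)) :
    Orthonormal ℝ fun β : Fin d → ℕ => polyLp hZ (hermPoly β) := by
  classical
  rw [orthonormal_iff_ite]
  intro β β'
  rw [hermPoly, hermPoly, inner_separated]
  simp only [integral_C_mul_mul_C_mul, integral_hermiteReal_mul_hermiteReal]
  split_ifs with h
  · subst h
    refine Finset.prod_eq_one fun i _ => ?_
    have h0 : (0 : ℝ) < (β i).factorial := by positivity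
    rw [if_pos rfl, ← mul_inv, Real.mul_self_sqrt h0.le, inv_mul_cancel₀ h0.ne']
  · obtain ⟨i, hi⟩ := Function.ne_iff.mp h
    exact Finset.prod_eq_zero (Finset.mem_univ i) (by rw [if_neg hi, mul_zero])

theorem inner_monoPoly_hermPoly (hZ : MeasurePreserving Z μ (stdGaussianPi d))
    {κ β : Fin d → ℕ} (h : ∑ i, κ i < ∑ i, β i) :
    ⟪polyLp hZ (monoPoly κ), polyLp hZ (hermPoly β)⟫_ℝ = 0 := by
  obtain ⟨i, -, hi⟩ := Finset.exists_lt_of_sum_lt h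
  rw [monoPoly, hermPoly, inner_separated]
  refine Finset.prod_eq_zero (Finset.mem_univ i) ?_
  rw [integral_C_mul_mul_C_mul, mul_comm (_ ^ _),
    integral_hermiteReal_mul _ _ (by rw [Polynomial.natDegree_X_pow]; exact hi.le),
    Polynomial.coeff_X_pow, if_neg hi.ne', mul_zero, mul_zero]

theorem norm_sq_polyLp_monoPoly_le (hZ : MeasurePreserving Z μ (stdGaussianPi d))
    (β : Fin d → ℕ) : ‖polyLp hZ (monoPoly β)‖ ^ 2 ≤ 2 ^ ∑ i, β i := by
  rw [← real_inner_self_eq_norm_sq, monoPoly, inner_separated, ← Finset.prod_pow_eq_pow_sum]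
  have e : ∀ i, ∫ x, ((Polynomial.C (√((β i).factorial : ℝ))⁻¹ * Polynomial.X ^ (β i)) *
      (Polynomial.C (√((β i).factorial : ℝ))⁻¹ * Polynomial.X ^ (β i))).eval x ∂(gaussianReal 0 1)
      = ((β i).factorial : ℝ)⁻¹ * ∫ x, x ^ (2 * β i) ∂(gaussianReal 0 1) := by
    intro i
    rw [integral_C_mul_mul_C_mul, ← mul_inv, Real.mul_self_sqrt (by positivity)]
    simp [← pow_add, two_mul]
  refine Finset.prod_le_prod (fun i _ => ?_) fun i _ => ?_
  · rw [e]
    exact mul_nonneg (by positivity)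
      (integral_nonneg fun x => by simp only [pow_mul]; positivity)
  · rw [e, inv_mul_le_iff₀ (by positivity), mul_comm ((β i).factorial : ℝ)]
    exact integral_pow_two_mul_gaussianReal_le _

theorem hermPoly_sub_monoPoly_mem (β : Fin d → ℕ) :
    hermPoly β - monoPoly β
      ∈ Submodule.span ℝ (monoPoly '' {κ : Fin d → ℕ | ∑ i, κ i < ∑ i, β i}) := by
  classical
  have hc : ∀ κ : Fin d → ℕ, ∀ a : Fin d → ℝ,
      separated (fun i => Polynomial.C (a i) * Polynomial.X ^ κ i)
        = (∏ i, a i * √((κ i).factorial : ℝ)) • monoPoly κ := by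
    intro κ a
    rw [monoPoly, separated, separated, MvPolynomial.smul_eq_C_mul, map_prod,
      ← Finset.prod_mul_distrib]
    refine Finset.prod_congr rfl fun i _ => ?_
    have h0 : √((κ i).factorial : ℝ) ≠ 0 := by positivity
    simp only [map_mul, Polynomial.aeval_C, map_pow, Polynomial.aeval_X,
      MvPolynomial.algebraMap_eq]
    have h1 : MvPolynomial.C (√((κ i).factorial : ℝ)) * MvPolynomial.C (√((κ i).factorial : ℝ))⁻¹
        = (1 : MvPolynomial (Fin d) ℝ) := by
      rw [← map_mul, mul_inv_cancel₀ h0, map_one]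
    linear_combination -(MvPolynomial.C (a i) * MvPolynomial.X i ^ κ i) * h1
  set s : Fin d → ℝ := fun i => (√((β i).factorial : ℝ))⁻¹ with hs
  have hexp : hermPoly β = ∑ κ ∈ Fintype.piFinset fun i => Finset.range (β i + 1),
      separated fun i => Polynomial.C (s i * (hermiteReal (β i)).coeff (κ i)) *
        Polynomial.X ^ κ i := by
    simp only [separated]
    rw [← Finset.prod_univ_sum (fun i => Finset.range (β i + 1)) fun i k =>
      Polynomial.aeval (MvPolynomial.X i : MvPolynomial (Fin d) ℝ)
        (Polynomial.C (s i * (hermiteReal (β i)).coeff k) * Polynomial.X ^ k)]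
    rw [hermPoly, separated]
    refine Finset.prod_congr rfl fun i _ => ?_
    rw [← map_sum]
    congr 1
    conv_lhs => rw [(hermiteReal (β i)).as_sum_range_C_mul_X_pow, natDegree_hermiteReal,
      Finset.mul_sum]
    simp only [map_mul, mul_assoc, hs]
  have hβ : β ∈ Fintype.piFinset fun i => Finset.range (β i + 1) := by simp
  have hlead : separated (fun i => Polynomial.C (s i * (hermiteReal (β i)).coeff (β i)) *
      Polynomial.X ^ β i) = monoPoly β := by
    rw [monoPoly]
    congr 1
    ext1 i
    have := (monic_hermiteReal (β i)).coeff_natDegree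
    rw [natDegree_hermiteReal] at this
    rw [this, mul_one]
  rw [hexp, ← Finset.add_sum_erase _ _ hβ, hlead, add_sub_cancel_left]
  refine Submodule.sum_mem _ fun κ hκ => ?_
  rw [hc]
  refine Submodule.smul_mem _ _ (Submodule.subset_span ⟨κ, ?_, rfl⟩)
  rw [Finset.mem_erase, Fintype.mem_piFinset] at hκ
  have hle : ∀ i, κ i ≤ β i := fun i => by have := Finset.mem_range.mp (hκ.2 i); omega
  obtain ⟨i, hi⟩ := Function.ne_iff.mp hκ.1
  exact Finset.sum_lt_sum (fun i _ => hle i) ⟨i, Finset.mem_univ _, lt_of_le_of_ne (hle i) hi⟩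

theorem sum_pow_div_factorial (γ : Fin d → ℝ) (z w : Fin d → ℝ) (n : ℕ) :
    (∑ i, γ i * z i * w i) ^ n / (n.factorial : ℝ)
      = ∑ β ∈ Finset.piAntidiag Finset.univ n, (∏ i, γ i ^ β i) *
        (MvPolynomial.eval z (monoPoly β) * MvPolynomial.eval w (monoPoly β)) := by
  rw [Finset.sum_pow_eq_sum_piAntidiag, Finset.sum_div]
  refine Finset.sum_congr rfl fun β hβ => ?_
  have hsum := (Finset.mem_piAntidiag.mp hβ).1
  have hm := Nat.multinomial_spec Finset.univ β
  rw [hsum] at hm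
  have hm' : (∏ i, ((β i).factorial : ℝ)) * (Nat.multinomial Finset.univ β : ℝ)
      = (n.factorial : ℝ) := by exact_mod_cast hm
  have h0 : (∏ i, ((β i).factorial : ℝ)) ≠ 0 :=
    Finset.prod_ne_zero_iff.mpr fun i _ => by positivity
  have hn0 : (n.factorial : ℝ) ≠ 0 := by positivity
  have e : ∀ i, √((β i).factorial : ℝ)⁻¹ * √((β i).factorial : ℝ)⁻¹ = ((β i).factorial : ℝ)⁻¹ :=
    fun i => Real.mul_self_sqrt (by positivity)
  have : (Nat.multinomial Finset.univ β : ℝ) / n.factorial = ∏ i, ((β i).factorial : ℝ)⁻¹ := by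
    rw [Finset.prod_inv_distrib, ← hm']
    have : (Nat.multinomial Finset.univ β : ℝ) ≠ 0 := by
      intro h; rw [h, mul_zero] at hm'; exact hn0 hm'.symm
    field_simp
  rw [mul_div_right_comm, this, eval_monoPoly, eval_monoPoly, ← Finset.prod_mul_distrib,
    ← Finset.prod_mul_distrib, ← Finset.prod_mul_distrib]
  refine Finset.prod_congr rfl fun i _ => ?_
  rw [← e, Real.sqrt_inv]
  ring

end GaussianPolynomials

section FiniteRankSeries

variable {H : Type*} [NormedAddCommGroup H] [InnerProductSpace ℝ H]
variable {ι : Type*} [Fintype ι]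

theorem norm_diagOp_le (ℓ : ι → ℝ) (φ : ι → H) : ‖diagOp ℓ φ‖ ≤ ∑ i, |ℓ i| * ‖φ i‖ ^ 2 := by
  refine (norm_sum_le _ _).trans (Finset.sum_le_sum fun i _ => ?_)
  rw [norm_smul, InnerProductSpace.norm_rankOne, Real.norm_eq_abs, sq]

theorem inner_diagOp (ℓ : ι → ℝ) (φ : ι → H) (x y : H) :
    ⟪diagOp ℓ φ x, y⟫_ℝ = ∑ i, ℓ i * ⟪φ i, x⟫_ℝ * ⟪φ i, y⟫_ℝ := by
  simp only [diagOp_apply, sum_inner, real_inner_smul_left]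

theorem inner_diagOp_comm (ℓ : ι → ℝ) (φ : ι → H) (x y : H) :
    ⟪diagOp ℓ φ x, y⟫_ℝ = ⟪x, diagOp ℓ φ y⟫_ℝ := by
  rw [real_inner_comm (diagOp ℓ φ y) x, inner_diagOp, inner_diagOp]
  exact Finset.sum_congr rfl fun i _ => by ring

theorem isCompactOperator_sum {J E F : Type*} [NormedAddCommGroup E] [NormedSpace ℝ E]
    [NormedAddCommGroup F] [NormedSpace ℝ F] (s : Finset J) {T : J → E →L[ℝ] F}
    (hT : ∀ j ∈ s, IsCompactOperator (T j)) : IsCompactOperator (∑ j ∈ s, T j : E →L[ℝ] F) := by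
  classical
  induction s using Finset.induction_on with
  | empty => simpa using isCompactOperator_zero
  | insert j s hj ih =>
    rw [Finset.sum_insert hj]
    exact (hT j (Finset.mem_insert_self _ _)).add
      (ih fun i hi => hT i (Finset.mem_insert_of_mem hi))

theorem isCompactOperator_diagOp (ℓ : ι → ℝ) (φ : ι → H) : IsCompactOperator (diagOp ℓ φ) := by
  refine isCompactOperator_sum _ fun i _ => IsCompactOperator.smul ?_ (ℓ i)
  rw [InnerProductSpace.rankOne_def']
  exact (isCompactOperator_of_locallyCompactSpace_rng (ContinuousLinearMap.toSpanSingleton ℝ (φ i))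
    ).comp_clm (innerSL ℝ (φ i))

theorem isCompactOperator_of_hasSum [CompleteSpace H] {A : ℕ → H →L[ℝ] H} {T : H →L[ℝ] H}
    (hA : ∀ n, IsCompactOperator (A n)) (hT : HasSum A T) : IsCompactOperator T :=
  isCompactOperator_of_tendsto hT.tendsto_sum_nat
    (Filter.Eventually.of_forall fun _ => isCompactOperator_sum _ fun n _ => hA n)

theorem hasSum_inner_apply {A : ℕ → H →L[ℝ] H} {T : H →L[ℝ] H} (hT : HasSum A T) (x y : H) :
    HasSum (fun n => ⟪A n x, y⟫_ℝ) ⟪T x, y⟫_ℝ := by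
  have h1 : HasSum (fun n => A n x) (T x) := hT.mapL (ContinuousLinearMap.apply ℝ H x)
  have h2 := h1.mapL (innerSL ℝ y)
  simpa only [innerSL_apply_apply, real_inner_comm] using h2

/-- A finite family of vectors with positive weights is coercive on its span. -/
theorem exists_pos_mul_norm_sq_le_sum {φ : ι → H} {w : ι → ℝ} (hw : ∀ i, 0 < w i) :
    ∃ κ : ℝ, 0 < κ ∧ ∀ u ∈ Submodule.span ℝ (Set.range φ),
      κ * ‖u‖ ^ 2 ≤ ∑ i, w i * ⟪φ i, u⟫_ℝ ^ 2 := by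
  set W := Submodule.span ℝ (Set.range φ) with hW
  have : FiniteDimensional ℝ W := FiniteDimensional.span_of_finite ℝ (Set.finite_range φ)
  let L : W →ₗ[ℝ] (ι → ℝ) := LinearMap.pi fun i => (innerₗ H (φ i)) ∘ₗ W.subtype
  have hL : ∀ (u : W) i, L u i = ⟪φ i, (u : H)⟫_ℝ := fun u i => rfl
  have hker : L.ker = ⊥ := by
    rw [LinearMap.ker_eq_bot']
    intro u hu
    have h1 : ∀ v ∈ W, ⟪v, (u : H)⟫_ℝ = 0 := by
      intro v hv
      induction hv using Submodule.span_induction with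
      | mem x hx =>
        obtain ⟨i, rfl⟩ := hx
        rw [← hL, hu]
        rfl
      | zero => simp
      | add x y _ _ hx hy => rw [inner_add_left, hx, hy, add_zero]
      | smul a x _ hx => rw [real_inner_smul_left, hx, mul_zero]
    exact Subtype.ext (inner_self_eq_zero.mp (h1 u u.2))
  obtain ⟨K, hK, hKL⟩ := L.exists_antilipschitzWith hker
  obtain ⟨a, ha, haw⟩ := exists_pos_le_of_finite w hw
  have hK' : (0 : ℝ) < K := hK
  refine ⟨a / (K : ℝ) ^ 2, by positivity, fun u hu => ?_⟩
  have h1 : ‖u‖ ≤ K * ‖L ⟨u, hu⟩‖ := by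
    have := hKL.le_mul_dist ⟨u, hu⟩ 0
    simpa using this
  set S := ∑ i, ⟪φ i, u⟫_ℝ ^ 2 with hS
  have hS0 : 0 ≤ S := Finset.sum_nonneg fun i _ => sq_nonneg _
  have h2 : ‖L ⟨u, hu⟩‖ ≤ √S := by
    refine (pi_norm_le_iff_of_nonneg (Real.sqrt_nonneg _)).mpr fun i => ?_
    rw [hL]
    refine Real.abs_le_sqrt ?_
    exact Finset.single_le_sum (f := fun i => ⟪φ i, u⟫_ℝ ^ 2) (fun i _ => sq_nonneg _)
      (Finset.mem_univ i)
  have h3 : ‖u‖ ^ 2 ≤ (K : ℝ) ^ 2 * S := by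
    have h4 : ‖u‖ ≤ K * √S := h1.trans (mul_le_mul_of_nonneg_left h2 hK'.le)
    calc ‖u‖ ^ 2 ≤ (K * √S) ^ 2 := by gcongr
      _ = _ := by rw [mul_pow, Real.sq_sqrt hS0]
  calc a / (K : ℝ) ^ 2 * ‖u‖ ^ 2 ≤ a / (K : ℝ) ^ 2 * ((K : ℝ) ^ 2 * S) := by gcongr
    _ = ∑ i, a * ⟪φ i, u⟫_ℝ ^ 2 := by rw [hS, ← Finset.mul_sum]; field_simp
    _ ≤ _ := Finset.sum_le_sum fun i _ => mul_le_mul_of_nonneg_right (haw i) (sq_nonneg _)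

end FiniteRankSeries

section DotProductOperator

open ProbabilityTheory

variable {d : ℕ}

/-- The multi-indices of total degree `n`. -/
abbrev MultiIdx (d n : ℕ) : Type :=
  {β : Fin d → ℕ // β ∈ Finset.piAntidiag (Finset.univ : Finset (Fin d)) n}

theorem MultiIdx.sum_eq {n : ℕ} (β : MultiIdx d n) : ∑ i, β.1 i = n :=
  (Finset.mem_piAntidiag.mp β.2).1

theorem sum_prod_pow_le {γ : Fin d → ℝ} (hγ : ∀ i, 0 < γ i) (n : ℕ) :
    ∑ β : MultiIdx d n, ∏ i, γ i ^ β.1 i ≤ (∑ i, γ i) ^ n := by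
  rw [Finset.sum_pow_eq_sum_piAntidiag,
    Finset.sum_coe_sort (Finset.piAntidiag Finset.univ n) fun β => ∏ i, γ i ^ β i]
  refine Finset.sum_le_sum fun β _ => le_mul_of_one_le_left ?_ ?_
  · exact Finset.prod_nonneg fun i _ => pow_nonneg (hγ i).le _
  · exact_mod_cast Nat.multinomial_pos _ _

theorem sum_multiIdx_mul_eval (γ : Fin d → ℝ) (z w : Fin d → ℝ) (n : ℕ) :
    (∑ i, γ i * z i * w i) ^ n / (n.factorial : ℝ)
      = ∑ β : MultiIdx d n, (∏ i, γ i ^ β.1 i) *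
        (MvPolynomial.eval z (monoPoly β.1) * MvPolynomial.eval w (monoPoly β.1)) := by
  rw [sum_pow_div_factorial]
  exact (Finset.sum_coe_sort (Finset.piAntidiag Finset.univ n) fun β => (∏ i, γ i ^ β i) *
        (MvPolynomial.eval z (monoPoly β) * MvPolynomial.eval w (monoPoly β))).symm

variable {Ω : Type*} [MeasurableSpace Ω] {μ : Measure Ω} {Z : Ω → Fin d → ℝ}

/-- The integral operator on `L²(μ)` with kernel `(∑ γᵢ Zᵢ(x) Zᵢ(y))^n / n!`. -/
noncomputable def levelOp (hZ : MeasurePreserving Z μ (stdGaussianPi d)) (γ : Fin d → ℝ) (n : ℕ) :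
    Lp ℝ 2 μ →L[ℝ] Lp ℝ 2 μ :=
  diagOp (fun β : MultiIdx d n => ∏ i, γ i ^ β.1 i) fun β => polyLp hZ (monoPoly β.1)

variable (hZ : MeasurePreserving Z μ (stdGaussianPi d)) {γ : Fin d → ℝ} (hγ : ∀ i, 0 < γ i)

include hγ in
theorem norm_levelOp_le (n : ℕ) : ‖levelOp hZ γ n‖ ≤ (2 * ∑ i, γ i) ^ n := by
  refine (norm_diagOp_le _ _).trans ?_
  calc ∑ β : MultiIdx d n, |∏ i, γ i ^ β.1 i| * ‖polyLp hZ (monoPoly β.1)‖ ^ 2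
      ≤ ∑ β : MultiIdx d n, (∏ i, γ i ^ β.1 i) * 2 ^ n := by
        refine Finset.sum_le_sum fun β _ => ?_
        have h0 : 0 ≤ ∏ i, γ i ^ β.1 i := Finset.prod_nonneg fun i _ => pow_nonneg (hγ i).le _
        rw [abs_of_nonneg h0]
        have := norm_sq_polyLp_monoPoly_le hZ β.1
        rw [β.sum_eq] at this
        gcongr
    _ = 2 ^ n * ∑ β : MultiIdx d n, ∏ i, γ i ^ β.1 i := by rw [← Finset.sum_mul, mul_comm]
    _ ≤ 2 ^ n * (∑ i, γ i) ^ n := by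
        gcongr
        exact sum_prod_pow_le hγ n
    _ = _ := by rw [mul_pow]

theorem coeFn_levelOp (n : ℕ) (f : Lp ℝ 2 μ) :
    (levelOp hZ γ n f : Ω → ℝ) =ᵐ[μ] fun ω => ∑ β : MultiIdx d n,
      (∏ i, γ i ^ β.1 i) * (MvPolynomial.eval (Z ω) (monoPoly β.1) *
        ⟪polyLp hZ (monoPoly β.1), f⟫_ℝ) := by
  have h : levelOp hZ γ n f = polyLp hZ (∑ β : MultiIdx d n,
      ((∏ i, γ i ^ β.1 i) * ⟪polyLp hZ (monoPoly β.1), f⟫_ℝ) • monoPoly β.1) := by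
    rw [levelOp, diagOp_apply]
    simp only [map_sum, map_smul]
  rw [h]
  filter_upwards [coeFn_polyLp hZ (∑ β : MultiIdx d n,
      ((∏ i, γ i ^ β.1 i) * ⟪polyLp hZ (monoPoly β.1), f⟫_ℝ) • monoPoly β.1)] with ω hω
  rw [hω, map_sum]
  refine Finset.sum_congr rfl fun β _ => ?_
  rw [MvPolynomial.smul_eval]
  ring

include hZ in
theorem integrable_eval_mul (p : MvPolynomial (Fin d) ℝ) (f : Lp ℝ 2 μ) :
    Integrable (fun ω => MvPolynomial.eval (Z ω) p * f ω) μ :=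
  (memLp_eval_comp hZ p).integrable_mul (Lp.memLp f)

include hZ in
theorem integrable_kernelTerm (γ z : Fin d → ℝ) (n : ℕ) (f : Lp ℝ 2 μ) :
    Integrable (fun ω => (∑ i, γ i * z i * Z ω i) ^ n / (n.factorial : ℝ) * f ω) μ := by
  simp only [sum_multiIdx_mul_eval]
  simp only [Finset.sum_mul, mul_assoc]
  exact integrable_finsetSum _ fun β _ => ((integrable_eval_mul hZ _ f).const_mul _).const_mul _

theorem integral_kernelTerm (γ z : Fin d → ℝ) (n : ℕ) (f : Lp ℝ 2 μ) :
    ∫ ω, (∑ i, γ i * z i * Z ω i) ^ n / (n.factorial : ℝ) * f ω ∂μ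
      = ∑ β : MultiIdx d n, (∏ i, γ i ^ β.1 i) * (MvPolynomial.eval z (monoPoly β.1) *
        ⟪polyLp hZ (monoPoly β.1), f⟫_ℝ) := by
  simp only [sum_multiIdx_mul_eval]
  simp only [Finset.sum_mul, mul_assoc]
  rw [integral_finsetSum _ fun β _ => ((integrable_eval_mul hZ _ f).const_mul _).const_mul _]
  refine Finset.sum_congr rfl fun β _ => ?_
  rw [integral_const_mul, integral_const_mul, inner_polyLp]

include hZ in
theorem integrable_diagTerm (γ : Fin d → ℝ) (n : ℕ) :
    Integrable (fun ω => (∑ i, γ i * Z ω i * Z ω i) ^ n / (n.factorial : ℝ)) μ := by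
  simp only [sum_multiIdx_mul_eval, ← map_mul]
  exact integrable_finsetSum _ fun β _ => (integrable_eval_comp hZ _).const_mul _

theorem integral_eval_mul_self (p : MvPolynomial (Fin d) ℝ) :
    ∫ ω, MvPolynomial.eval (Z ω) (p * p) ∂μ = ‖polyLp hZ p‖ ^ 2 := by
  rw [← real_inner_self_eq_norm_sq, inner_polyLp_polyLp, integral_eval_comp hZ]

include hZ hγ in
theorem integral_diagTerm_le (n : ℕ) :
    ∫ ω, (∑ i, γ i * Z ω i * Z ω i) ^ n / (n.factorial : ℝ) ∂μ ≤ (2 * ∑ i, γ i) ^ n := by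
  simp only [sum_multiIdx_mul_eval, ← map_mul]
  rw [integral_finsetSum _ fun β _ => (integrable_eval_comp hZ _).const_mul _]
  calc _ = ∑ β : MultiIdx d n, (∏ i, γ i ^ β.1 i) * ‖polyLp hZ (monoPoly β.1)‖ ^ 2 := by
        refine Finset.sum_congr rfl fun β _ => ?_
        rw [integral_const_mul, integral_eval_mul_self hZ]
    _ ≤ ∑ β : MultiIdx d n, (∏ i, γ i ^ β.1 i) * 2 ^ n := by
        refine Finset.sum_le_sum fun β _ => ?_
        have h0 : 0 ≤ ∏ i, γ i ^ β.1 i := Finset.prod_nonneg fun i _ => pow_nonneg (hγ i).le _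
        have := norm_sq_polyLp_monoPoly_le hZ β.1
        rw [β.sum_eq] at this
        gcongr
    _ = 2 ^ n * ∑ β : MultiIdx d n, ∏ i, γ i ^ β.1 i := by rw [← Finset.sum_mul, mul_comm]
    _ ≤ 2 ^ n * (∑ i, γ i) ^ n := by
        gcongr
        exact sum_prod_pow_le hγ n
    _ = _ := by rw [mul_pow]

include hZ hγ in
theorem integral_norm_kernelTerm_le (z : Fin d → ℝ) (n : ℕ) (f : Lp ℝ 2 μ) :
    ∫ ω, ‖(∑ i, γ i * z i * Z ω i) ^ n / (n.factorial : ℝ) * f ω‖ ∂μ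
      ≤ (2 * ∑ i, γ i * z i * z i) ^ n / (n.factorial : ℝ) + (∑ i, γ i) ^ n * ‖f‖ ^ 2 := by
  have hw : ∀ β : MultiIdx d n, 0 ≤ ∏ i, γ i ^ β.1 i := fun β =>
    Finset.prod_nonneg fun i _ => pow_nonneg (hγ i).le _
  have hf2 : Integrable (fun ω => f ω ^ 2) μ := (Lp.memLp f).integrable_sq
  have hfn : ∫ ω, f ω ^ 2 ∂μ = ‖f‖ ^ 2 := by
    rw [← real_inner_self_eq_norm_sq, L2.inner_def]
    refine integral_congr_ae (Filter.Eventually.of_forall fun ω => ?_)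
    simp [sq]
  have hi : ∀ β : MultiIdx d n, Integrable (fun ω => (∏ i, γ i ^ β.1 i) *
      (MvPolynomial.eval z (monoPoly β.1) ^ 2 *
        MvPolynomial.eval (Z ω) (monoPoly β.1 * monoPoly β.1) + f ω ^ 2)) μ := fun β =>
    (((integrable_eval_comp hZ _).const_mul _).add hf2).const_mul _
  calc _ ≤ ∫ ω, ∑ β : MultiIdx d n, (∏ i, γ i ^ β.1 i) * (MvPolynomial.eval z (monoPoly β.1) ^ 2 *
        MvPolynomial.eval (Z ω) (monoPoly β.1 * monoPoly β.1) + f ω ^ 2) ∂μ := by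
        refine integral_mono (integrable_kernelTerm hZ γ z n f).norm
          (integrable_finsetSum _ fun β _ => hi β) fun ω => ?_
        simp only [sum_multiIdx_mul_eval]
        simp only [Finset.sum_mul, mul_assoc]
        refine (norm_sum_le _ _).trans (Finset.sum_le_sum fun β _ => ?_)
        rw [norm_mul, Real.norm_eq_abs, abs_of_nonneg (hw β)]
        refine mul_le_mul_of_nonneg_left ?_ (hw β)
        rw [map_mul, Real.norm_eq_abs, abs_le]
        constructor <;> nlinarith [sq_nonneg (MvPolynomial.eval z (monoPoly β.1) *
          MvPolynomial.eval (Z ω) (monoPoly β.1) + f ω), sq_nonneg (f ω),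
          sq_nonneg (MvPolynomial.eval z (monoPoly β.1) *
          MvPolynomial.eval (Z ω) (monoPoly β.1) - f ω),
          sq_nonneg (MvPolynomial.eval z (monoPoly β.1) *
          MvPolynomial.eval (Z ω) (monoPoly β.1))]
    _ = ∑ β : MultiIdx d n, (∏ i, γ i ^ β.1 i) * (MvPolynomial.eval z (monoPoly β.1) ^ 2 *
        ‖polyLp hZ (monoPoly β.1)‖ ^ 2 + ‖f‖ ^ 2) := by
        rw [integral_finsetSum _ fun β _ => hi β]
        refine Finset.sum_congr rfl fun β _ => ?_
        rw [integral_const_mul, integral_add ((integrable_eval_comp hZ _).const_mul _) hf2,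
          integral_const_mul, integral_eval_mul_self hZ, hfn]
    _ ≤ ∑ β : MultiIdx d n, (∏ i, γ i ^ β.1 i) * (MvPolynomial.eval z (monoPoly β.1) ^ 2 *
        2 ^ n + ‖f‖ ^ 2) := by
        refine Finset.sum_le_sum fun β _ => ?_
        have := norm_sq_polyLp_monoPoly_le hZ β.1
        rw [β.sum_eq] at this
        have h1 := hw β
        gcongr
    _ = 2 ^ n * ((∑ i, γ i * z i * z i) ^ n / (n.factorial : ℝ))
        + (∑ β : MultiIdx d n, ∏ i, γ i ^ β.1 i) * ‖f‖ ^ 2 := by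
        rw [sum_multiIdx_mul_eval, Finset.mul_sum, Finset.sum_mul, ← Finset.sum_add_distrib]
        exact Finset.sum_congr rfl fun β _ => by ring
    _ ≤ _ := by
        rw [mul_pow, mul_div_assoc]
        gcongr
        exact sum_prod_pow_le hγ n

variable {c : ℕ → ℝ} {B r : ℝ}

theorem summable_abs_coeff_mul_pow (hc : ∀ n, 0 ≤ c n) (hcB : ∀ n, c n ≤ B * r ^ n) (s : ℝ) :
    Summable fun n : ℕ => |c n / (n.factorial : ℝ) * s ^ n| := by
  refine Summable.of_nonneg_of_le (fun n => abs_nonneg _) (fun n => ?_)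
    ((Real.summable_pow_div_factorial (r * |s|)).mul_left B)
  rw [abs_mul, abs_div, abs_of_nonneg (hc n), abs_pow, Nat.abs_cast, mul_pow, mul_div_assoc',
    ← mul_assoc, div_mul_eq_mul_div]
  gcongr
  exact hcB n

include hγ in
theorem coeff_mul_pow_le (hcB : ∀ n, c n ≤ B * r ^ n) (hr : 0 ≤ r)
    (hB : 0 ≤ B) (hrg : r * (2 * ∑ i, γ i) ≤ 1 / 2) (n : ℕ) :
    c n * (2 * ∑ i, γ i) ^ n ≤ B * (1 / 2) ^ n := by
  have hg : 0 ≤ 2 * ∑ i, γ i := mul_nonneg zero_le_two (Finset.sum_nonneg fun i _ => (hγ i).le)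
  calc c n * (2 * ∑ i, γ i) ^ n ≤ B * r ^ n * (2 * ∑ i, γ i) ^ n := by gcongr; exact hcB n
    _ = B * (r * (2 * ∑ i, γ i)) ^ n := by rw [mul_pow]; ring
    _ ≤ _ := by gcongr

end DotProductOperator

theorem integrable_tsum_of_summable_integral_norm {X : Type*} [MeasurableSpace X] {ν : Measure X}
    {F : ℕ → X → ℝ} (hF : ∀ n, Integrable (F n) ν) (hs : Summable fun n => ∫ x, ‖F n x‖ ∂ν) :
    Integrable (fun x => ∑' n, F n x) ν := by
  have hs' : Summable fun n => ‖(hF n).toL1 (F n)‖ := by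
    simpa only [L1.norm_of_fun_eq_integral_norm] using hs
  have h1 := Lp.coeFn_tsum (tsum_enorm_ne_top_iff_summable_norm.mpr hs')
  have h2 : ∀ᵐ x ∂ν, ∀ n, (hF n).toL1 (F n) x = F n x :=
    ae_all_iff.mpr fun n => (hF n).coeFn_toL1
  refine (L1.integrable_coeFn (∑' n, (hF n).toL1 (F n))).congr ?_
  filter_upwards [h1, h2] with x hx1 hx2
  rw [hx1]
  exact tsum_congr fun n => hx2 n

section DotProductSeries

variable {d : ℕ} {Ω : Type*} [MeasurableSpace Ω] {μ : Measure Ω} {Z : Ω → Fin d → ℝ}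

/-- The integral operator on `L²(μ)` with kernel `∑ₙ cₙ (∑ γᵢ Zᵢ(x) Zᵢ(y))^n / n!`. -/
noncomputable def dotOp (hZ : MeasurePreserving Z μ (stdGaussianPi d)) (γ : Fin d → ℝ)
    (c : ℕ → ℝ) : Lp ℝ 2 μ →L[ℝ] Lp ℝ 2 μ :=
  ∑' n, c n • levelOp hZ γ n

variable (hZ : MeasurePreserving Z μ (stdGaussianPi d)) {γ : Fin d → ℝ} (hγ : ∀ i, 0 < γ i)
  {c : ℕ → ℝ} (hc : ∀ n, 0 ≤ c n)

include hγ hc in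
theorem norm_smul_levelOp_le (n : ℕ) : ‖c n • levelOp hZ γ n‖ ≤ c n * (2 * ∑ i, γ i) ^ n := by
  rw [norm_smul, Real.norm_eq_abs, abs_of_nonneg (hc n)]
  exact mul_le_mul_of_nonneg_left (norm_levelOp_le hZ hγ n) (hc n)

variable (hs : Summable fun n => c n * (2 * ∑ i, γ i) ^ n)

include hγ hc hs in
theorem summable_norm_smul_levelOp : Summable fun n => ‖c n • levelOp hZ γ n‖ :=
  Summable.of_nonneg_of_le (fun _ => norm_nonneg _) (norm_smul_levelOp_le hZ hγ hc) hs

include hγ hc hs in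
theorem hasSum_dotOp : HasSum (fun n => c n • levelOp hZ γ n) (dotOp hZ γ c) :=
  (summable_norm_smul_levelOp hZ hγ hc hs).of_norm.hasSum

include hγ hc hs in
theorem isCompactOperator_dotOp : IsCompactOperator (dotOp hZ γ c) :=
  isCompactOperator_of_hasSum (fun n => (isCompactOperator_diagOp _ _).smul (c n))
    (hasSum_dotOp hZ hγ hc hs)

include hγ hc hs in
theorem inner_dotOp_comm (f g : Lp ℝ 2 μ) : ⟪dotOp hZ γ c f, g⟫_ℝ = ⟪f, dotOp hZ γ c g⟫_ℝ := by
  rw [real_inner_comm (dotOp hZ γ c g) f]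
  refine (hasSum_inner_apply (hasSum_dotOp hZ hγ hc hs) f g).unique ?_
  convert! hasSum_inner_apply (hasSum_dotOp hZ hγ hc hs) g f using 2 with n
  simp only [FunLike.coe_smul, Pi.smul_apply, real_inner_smul_left, levelOp]
  rw [inner_diagOp_comm, real_inner_comm]

include hγ hc hs in
theorem inner_dotOp_self_nonneg (f : Lp ℝ 2 μ) : 0 ≤ ⟪f, dotOp hZ γ c f⟫_ℝ := by
  rw [real_inner_comm]
  refine (hasSum_inner_apply (hasSum_dotOp hZ hγ hc hs) f f).nonneg fun n => ?_
  simp only [FunLike.coe_smul, Pi.smul_apply, real_inner_smul_left, levelOp, inner_diagOp]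
  refine mul_nonneg (hc n) (Finset.sum_nonneg fun β _ => ?_)
  rw [mul_assoc]
  exact mul_nonneg (Finset.prod_nonneg fun i _ => pow_nonneg (hγ i).le _) (mul_self_nonneg _)

include hZ hγ hc hs in
theorem integrable_diag_kernel :
    Integrable (fun ω => ∑' n : ℕ, c n / (n.factorial : ℝ) * (∑ i, γ i * Z ω i * Z ω i) ^ n) μ := by
  have hpos : ∀ n ω, 0 ≤ c n * ((∑ i, γ i * Z ω i * Z ω i) ^ n / (n.factorial : ℝ)) := by
    intro n ω
    refine mul_nonneg (hc n) (div_nonneg (pow_nonneg (Finset.sum_nonneg fun i _ => ?_) _)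
      (Nat.cast_nonneg _))
    rw [mul_assoc]
    exact mul_nonneg (hγ i).le (mul_self_nonneg _)
  have h := integrable_tsum_of_summable_integral_norm
    (fun n => (integrable_diagTerm hZ γ n).const_mul (c n)) ?_
  · refine h.congr (Filter.Eventually.of_forall fun ω => tsum_congr fun n => ?_)
    simp only [div_mul_eq_mul_div, mul_div_assoc]
  · refine Summable.of_nonneg_of_le (fun n => integral_nonneg fun ω => norm_nonneg _)
      (fun n => ?_) hs
    simp only [Real.norm_eq_abs, abs_of_nonneg (hpos n _)]
    rw [integral_const_mul]
    exact mul_le_mul_of_nonneg_left (integral_diagTerm_le hZ hγ n) (hc n)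

include hγ hc hs in
theorem coeFn_dotOp (hk : ∀ s : ℝ, Summable fun n : ℕ => |c n / (n.factorial : ℝ) * s ^ n|)
    (f : Lp ℝ 2 μ) :
    (dotOp hZ γ c f : Ω → ℝ) =ᵐ[μ] fun ω => ∫ ω', (∑' n : ℕ, c n / (n.factorial : ℝ) *
      (∑ i, γ i * Z ω i * Z ω' i) ^ n) * f ω' ∂μ := by
  have hγs : 0 ≤ ∑ i, γ i := Finset.sum_nonneg fun i _ => (hγ i).le
  have happ : dotOp hZ γ c f = ∑' n, c n • levelOp hZ γ n f :=
    (((hasSum_dotOp hZ hγ hc hs).mapL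
      (ContinuousLinearMap.apply ℝ (Lp ℝ 2 μ) f)).tsum_eq).symm
  have hsum : Summable fun n => ‖c n • levelOp hZ γ n f‖ :=
    Summable.of_nonneg_of_le (fun _ => norm_nonneg _)
      (fun n => (c n • levelOp hZ γ n).le_opNorm f)
      ((summable_norm_smul_levelOp hZ hγ hc hs).mul_right ‖f‖)
  have h1 := Lp.hasSum_coeFn_tsum (tsum_enorm_ne_top_iff_summable_norm.mpr hsum)
  have h2 : ∀ᵐ ω ∂μ, ∀ n, (c n • levelOp hZ γ n f : Lp ℝ 2 μ) ω
      = c n * levelOp hZ γ n f ω :=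
    ae_all_iff.mpr fun n => Lp.coeFn_smul (c n) (levelOp hZ γ n f)
  have h3 := ae_all_iff.mpr fun n => coeFn_levelOp (γ := γ) hZ n f
  rw [happ]
  filter_upwards [h1, h2, h3] with ω hω1 hω2 hω3
  simp only [hω2, hω3, ← integral_kernelTerm hZ] at hω1
  have h4 := hasSum_integral_of_summable_integral_norm
    (F := fun n ω' => c n * ((∑ i, γ i * Z ω i * Z ω' i) ^ n / (n.factorial : ℝ) * f ω')) (μ := μ)
    (fun n => (integrable_kernelTerm hZ γ (Z ω) n f).const_mul (c n)) ?_
  · simp only [integral_const_mul] at h4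
    rw [hω1.unique h4]
    refine integral_congr_ae (Filter.Eventually.of_forall fun ω' => ?_)
    simp only [← tsum_mul_right]
    exact tsum_congr fun n => by ring
  · have hb : Summable fun n : ℕ => c n / (n.factorial : ℝ) * (2 * ∑ i, γ i * Z ω i * Z ω i) ^ n
        + c n * (2 * ∑ i, γ i) ^ n * ‖f‖ ^ 2 :=
      (hk _).of_abs.add (hs.mul_right _)
    refine Summable.of_nonneg_of_le (fun n => integral_nonneg fun ω => norm_nonneg _)
      (fun n => ?_) hb
    simp only [norm_mul (c n), integral_const_mul, Real.norm_eq_abs (c n), abs_of_nonneg (hc n)]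
    calc _ ≤ c n * ((2 * ∑ i, γ i * Z ω i * Z ω i) ^ n / (n.factorial : ℝ)
          + (∑ i, γ i) ^ n * ‖f‖ ^ 2) :=
          mul_le_mul_of_nonneg_left (integral_norm_kernelTerm_le hZ hγ (Z ω) n f) (hc n)
      _ ≤ c n * ((2 * ∑ i, γ i * Z ω i * Z ω i) ^ n / (n.factorial : ℝ)
          + (2 * ∑ i, γ i) ^ n * ‖f‖ ^ 2) := by
          have := hc n
          gcongr
          linarith
      _ = _ := by ring

end DotProductSeries

theorem eigSpan_smul {H : Type*} [NormedAddCommGroup H] [InnerProductSpace ℝ H] (T : H →L[ℝ] H)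
    {a : ℝ} (ha : 0 < a) (lo hi : ℝ) :
    eigSpan (a • T) (Set.Icc (a * lo) (a * hi)) = eigSpan T (Set.Icc lo hi) := by
  have key : ∀ lam, Module.End.eigenspace ((a • T : H →L[ℝ] H) : H →ₗ[ℝ] H) (a * lam)
      = Module.End.eigenspace (T : H →ₗ[ℝ] H) lam := by
    intro lam
    ext x
    simp only [Module.End.mem_eigenspace_iff, ContinuousLinearMap.coe_coe, mul_smul,
      smul_apply]
    exact (smul_right_injective H ha.ne').eq_iff
  have himg : Set.Icc (a * lo) (a * hi) = (fun lam => a * lam) '' Set.Icc lo hi :=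
    (Set.image_mul_left_Icc' ha lo hi).symm
  rw [eigSpan, himg, iSup_image]
  simp only [key]
  rfl

theorem coeff_le_mul_pow {c : ℕ → ℝ} {ε : ℝ} (hε : 0 ≤ ε) (hstep : ∀ n, c (n + 1) ≤ ε * c n)
    (m n : ℕ) : c (n + m) ≤ ε ^ n * c m := by
  induction n with
  | zero => simp
  | succ n ih =>
    calc c (n + 1 + m) = c (n + m + 1) := by rw [add_right_comm]
      _ ≤ ε * c (n + m) := hstep _
      _ ≤ ε * (ε ^ n * c m) := by gcongr
      _ = _ := by ring

section DotProductSpectrum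

variable {d : ℕ} {Ω : Type*} [MeasurableSpace Ω] {μ : Measure Ω} {Z : Ω → Fin d → ℝ}

/-- The span in `L²(μ)` of the monomials of degree less than `N`. -/
noncomputable def lowSpan (hZ : MeasurePreserving Z μ (stdGaussianPi d)) (N : ℕ) :
    Submodule ℝ (Lp ℝ 2 μ) :=
  Submodule.span ℝ (Set.range fun p : (n : Fin N) × MultiIdx d n => polyLp hZ (monoPoly p.2.1))

variable (hZ : MeasurePreserving Z μ (stdGaussianPi d)) {γ : Fin d → ℝ} (hγ : ∀ i, 0 < γ i)
  (N : ℕ)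

instance : FiniteDimensional ℝ (lowSpan hZ N) :=
  FiniteDimensional.span_of_finite ℝ (Set.finite_range _)

theorem polyLp_monoPoly_mem_lowSpan {κ : Fin d → ℕ} {N : ℕ} (h : ∑ i, κ i < N) :
    polyLp hZ (monoPoly κ) ∈ lowSpan hZ N :=
  Submodule.subset_span ⟨⟨⟨∑ i, κ i, h⟩, ⟨κ, by simp [Finset.mem_piAntidiag]⟩⟩, rfl⟩

theorem polyLp_hermPoly_mem_lowSpan_orthogonal (β : MultiIdx d N) :
    polyLp hZ (hermPoly β.1) ∈ (lowSpan hZ N)ᗮ := by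
  rw [lowSpan, Submodule.mem_orthogonal]
  intro u hu
  induction hu using Submodule.span_induction with
  | mem x hx =>
    obtain ⟨p, rfl⟩ := hx
    refine inner_monoPoly_hermPoly hZ ?_
    rw [β.sum_eq, p.2.sum_eq]
    exact p.1.2
  | zero => exact inner_zero_left _
  | add x y _ _ hx hy => rw [inner_add_left, hx, hy, add_zero]
  | smul a x _ hx => rw [real_inner_smul_left, hx, mul_zero]

theorem polyLp_monoPoly_sub_hermPoly_mem (β : MultiIdx d N) :
    polyLp hZ (monoPoly β.1) - polyLp hZ (hermPoly β.1) ∈ lowSpan hZ N := by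
  rw [← neg_sub, ← map_sub]
  refine neg_mem ?_
  have h := Submodule.mem_map_of_mem (f := polyLp hZ) (hermPoly_sub_monoPoly_mem β.1)
  rw [Submodule.map_span] at h
  refine Submodule.span_le.mpr ?_ h
  rintro _ ⟨_, ⟨κ, hκ, rfl⟩, rfl⟩
  refine polyLp_monoPoly_mem_lowSpan hZ ?_
  rw [← β.sum_eq]
  exact hκ

theorem levelOp_apply_mem_lowSpan {n N : ℕ} (h : n < N) (x : Lp ℝ 2 μ) :
    levelOp hZ γ n x ∈ lowSpan hZ N := by
  rw [levelOp, diagOp_apply]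
  refine Submodule.sum_mem _ fun β _ => Submodule.smul_mem _ _ ?_
  exact polyLp_monoPoly_mem_lowSpan hZ (by rwa [β.sum_eq])

theorem levelOp_apply_eq_zero {n N : ℕ} (h : n < N) {x : Lp ℝ 2 μ} (hx : x ∈ (lowSpan hZ N)ᗮ) :
    levelOp hZ γ n x = 0 := by
  rw [levelOp, diagOp_apply]
  refine Finset.sum_eq_zero fun β _ => ?_
  rw [Submodule.inner_right_of_mem_orthogonal
    (polyLp_monoPoly_mem_lowSpan hZ (by rwa [β.sum_eq])) hx, mul_zero, zero_smul]

theorem inner_levelOp_self (n : ℕ) (u : Lp ℝ 2 μ) :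
    ⟪levelOp hZ γ n u, u⟫_ℝ
      = ∑ β : MultiIdx d n, (∏ i, γ i ^ β.1 i) * ⟪polyLp hZ (monoPoly β.1), u⟫_ℝ ^ 2 := by
  rw [levelOp, inner_diagOp]
  exact Finset.sum_congr rfl fun β _ => by ring

include hγ in
theorem inner_levelOp_self_nonneg (n : ℕ) (u : Lp ℝ 2 μ) : 0 ≤ ⟪levelOp hZ γ n u, u⟫_ℝ := by
  rw [inner_levelOp_self]
  exact Finset.sum_nonneg fun β _ =>
    mul_nonneg (Finset.prod_nonneg fun i _ => pow_nonneg (hγ i).le _) (sq_nonneg _)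

include hγ in
theorem exists_pos_mul_norm_sq_le_inner_levelOp :
    ∃ κ : ℝ, 0 < κ ∧ ∀ u ∈ lowSpan hZ N,
      κ * ‖u‖ ^ 2 ≤ ∑ n ∈ Finset.range N, ⟪levelOp hZ γ n u, u⟫_ℝ := by
  obtain ⟨κ, hκ, h⟩ := exists_pos_mul_norm_sq_le_sum
    (φ := fun p : (n : Fin N) × MultiIdx d n => polyLp hZ (monoPoly p.2.1))
    (w := fun p => ∏ i, γ i ^ p.2.1 i) fun p => Finset.prod_pos fun i _ => pow_pos (hγ i) _
  refine ⟨κ, hκ, fun u hu => (h u hu).trans_eq ?_⟩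
  rw [Fintype.sum_sigma, Finset.sum_range]
  exact Finset.sum_congr rfl fun n _ => (inner_levelOp_self hZ n u).symm

include hγ in
theorem exists_isScaleSeparated :
    ∃ κ : ℝ, 0 < κ ∧ ∀ ε : ℝ, 0 ≤ ε → ε ≤ 1 → ε * (2 * ∑ i, γ i) ≤ 1 / 2 →
      ∀ c : ℕ → ℝ, (∀ n, 0 ≤ c n) → (∀ n, c (n + 1) ≤ ε * c n) → c N = 1 →
        IsScaleSeparated (lowSpan hZ N) κ (2 * (2 * ∑ i, γ i) ^ (N + 1)) ε
          (∑ n ∈ Finset.range N, c n • levelOp hZ γ n)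
          (∑' n, c (n + (N + 1)) • levelOp hZ γ (n + (N + 1))) := by
  obtain ⟨κ, hκ, hcoer⟩ := exists_pos_mul_norm_sq_le_inner_levelOp hZ hγ N
  refine ⟨κ, hκ, fun ε hε0 hε1 hεg c hc hstep hcN => ?_⟩
  have hg : 0 ≤ 2 * ∑ i, γ i := mul_nonneg zero_le_two (Finset.sum_nonneg fun i _ => (hγ i).le)
  have happ : ∀ x, (∑ n ∈ Finset.range N, c n • levelOp hZ γ n) x
      = ∑ n ∈ Finset.range N, c n • levelOp hZ γ n x := by
    intro x
    simp
  have hanti : Antitone c := antitone_nat_of_succ_le fun n =>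
    (hstep n).trans (mul_le_of_le_one_left (hc n) hε1)
  refine ⟨fun x => ?_, fun x hx => ?_, fun u hu => ?_, ?_⟩
  · rw [happ]
    exact Submodule.sum_mem _ fun n hn => Submodule.smul_mem _ _
      (levelOp_apply_mem_lowSpan hZ (Finset.mem_range.mp hn) x)
  · rw [happ]
    refine Finset.sum_eq_zero fun n hn => ?_
    rw [levelOp_apply_eq_zero hZ (Finset.mem_range.mp hn) hx, smul_zero]
  · have h1 : κ * ‖u‖ ^ 2 ≤ ε * ⟪∑ n ∈ Finset.range N, c n • levelOp hZ γ n u, u⟫_ℝ := by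
      refine (hcoer u hu).trans ?_
      rw [sum_inner, Finset.mul_sum]
      refine Finset.sum_le_sum fun n hn => ?_
      rw [real_inner_smul_left, ← mul_assoc]
      refine le_mul_of_one_le_left (inner_levelOp_self_nonneg hZ hγ n u) ?_
      exact hcN.symm.le.trans ((hanti (Finset.mem_range.mp hn)).trans (hstep n))
    have h2 := real_inner_le_norm (∑ n ∈ Finset.range N, c n • levelOp hZ γ n u) u
    rw [happ]
    rcases (norm_nonneg u).eq_or_lt with h0 | h0
    · rw [← h0, mul_zero]
      positivity
    · refine le_of_mul_le_mul_right ?_ h0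
      nlinarith [mul_le_mul_of_nonneg_left h2 hε0]
  · have hb : ∀ n, ‖c (n + (N + 1)) • levelOp hZ γ (n + (N + 1))‖
        ≤ ε * (2 * ∑ i, γ i) ^ (N + 1) * (1 / 2) ^ n := by
      intro n
      refine (norm_smul_levelOp_le hZ hγ hc _).trans ?_
      have h1 : c (n + (N + 1)) ≤ ε ^ n * ε := by
        refine (coeff_le_mul_pow hε0 hstep (N + 1) n).trans ?_
        gcongr
        simpa [hcN] using hstep N
      calc c (n + (N + 1)) * (2 * ∑ i, γ i) ^ (n + (N + 1))
          ≤ ε ^ n * ε * (2 * ∑ i, γ i) ^ (n + (N + 1)) := by gcongr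
        _ = ε * (2 * ∑ i, γ i) ^ (N + 1) * (ε * (2 * ∑ i, γ i)) ^ n := by rw [mul_pow]; ring
        _ ≤ _ := by gcongr
    refine (tsum_of_norm_bounded (hasSum_geometric_two.mul_left _) hb).trans_eq ?_
    ring

variable {c : ℕ → ℝ}

theorem dotOp_eq_add_add (hs : Summable fun n => c n • levelOp hZ γ n) (hcN : c N = 1) :
    dotOp hZ γ c = (∑ n ∈ Finset.range N, c n • levelOp hZ γ n)
      + diagOp (fun β : MultiIdx d N => ∏ i, γ i ^ β.1 i) (fun β => polyLp hZ (monoPoly β.1))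
      + ∑' n, c (n + (N + 1)) • levelOp hZ γ (n + (N + 1)) := by
  rw [dotOp, ← hs.sum_add_tsum_nat_add (N + 1), Finset.sum_range_succ, hcN, one_smul]
  rfl

theorem dotOp_smul (a : ℝ) : dotOp hZ γ (fun n => a * c n) = a • dotOp hZ γ c := by
  simp only [dotOp, mul_smul]
  exact tsum_const_smul'' a

include hγ in
theorem summable_coeff_mul_pow {ε : ℝ} (hε : 0 ≤ ε) (hεg : ε * (2 * ∑ i, γ i) ≤ 1 / 2)
    (hc : ∀ n, 0 ≤ c n) (hstep : ∀ n, c (n + 1) ≤ ε * c n) :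
    Summable fun n => c n * (2 * ∑ i, γ i) ^ n := by
  have hg : 0 ≤ 2 * ∑ i, γ i := mul_nonneg zero_le_two (Finset.sum_nonneg fun i _ => (hγ i).le)
  refine Summable.of_nonneg_of_le (fun n => mul_nonneg (hc n) (pow_nonneg hg n))
    (coeff_mul_pow_le hγ (fun n => ?_) hε (hc 0) hεg) (summable_geometric_two.mul_left (c 0))
  simpa [mul_comm] using coeff_le_mul_pow hε hstep 0 n

include hγ in
theorem exists_dotOp_spectral_bounds_of_coeff_eq_one :
    ∃ C D ε₀ : ℝ, 0 < C ∧ 0 < D ∧ 0 < ε₀ ∧ ε₀ * (2 * ∑ i, γ i) ≤ 1 / 2 ∧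
      ∀ ε : ℝ, ε ∈ Set.Icc 0 ε₀ → ∀ c : ℕ → ℝ, (∀ n, 0 ≤ c n) → (∀ n, c (n + 1) ≤ ε * c n) →
        c N = 1 → ∀ α : MultiIdx d N,
          Module.finrank ℝ (eigSpan (dotOp hZ γ c)
              (Set.Icc ((∏ i, γ i ^ α.1 i) * (1 - C * ε)) ((∏ i, γ i ^ α.1 i) * (1 + C * ε))))
            = Module.finrank ℝ (Submodule.span ℝ ((fun β : MultiIdx d N =>
                polyLp hZ (hermPoly β.1)) '' {β | ∏ i, γ i ^ β.1 i = ∏ i, γ i ^ α.1 i})) ∧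
          ∃ P Q : Lp ℝ 2 μ →L[ℝ] Lp ℝ 2 μ,
            IsOrthoProj P (Submodule.span ℝ ((fun β : MultiIdx d N =>
                polyLp hZ (hermPoly β.1)) '' {β | ∏ i, γ i ^ β.1 i = ∏ i, γ i ^ α.1 i})) ∧
            IsOrthoProj Q (eigSpan (dotOp hZ γ c)
              (Set.Icc ((∏ i, γ i ^ α.1 i) * (1 - C * ε)) ((∏ i, γ i ^ α.1 i) * (1 + C * ε)))) ∧
            ‖P - Q‖ ≤ D * ε := by
  have hg : 0 ≤ 2 * ∑ i, γ i := mul_nonneg zero_le_two (Finset.sum_nonneg fun i _ => (hγ i).le)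
  obtain ⟨κ, hκ, hsep⟩ := exists_isScaleSeparated hZ hγ N
  obtain ⟨C, D, ε₁, hC, hD, hε₁, h⟩ := exists_perturbation_bounds
    (e := fun β : MultiIdx d N => polyLp hZ (hermPoly β.1))
    (φ := fun β : MultiIdx d N => polyLp hZ (monoPoly β.1))
    (ℓ := fun β : MultiIdx d N => ∏ i, γ i ^ β.1 i) (W := lowSpan hZ N)
    ((orthonormal_polyLp_hermPoly hZ).comp _ Subtype.val_injective)
    (polyLp_hermPoly_mem_lowSpan_orthogonal hZ N) (polyLp_monoPoly_sub_hermPoly_mem hZ N)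
    (fun β => Finset.prod_pos fun i _ => pow_pos (hγ i) _) hκ
    (K := 2 * (2 * ∑ i, γ i) ^ (N + 1)) (by positivity)
  have hmin : min ε₁ (min 1 (1 / (2 * (2 * ∑ i, γ i + 1)))) * (2 * ∑ i, γ i) ≤ 1 / 2 := by
    calc _ ≤ 1 / (2 * (2 * ∑ i, γ i + 1)) * (2 * ∑ i, γ i) := by
          gcongr
          exact (min_le_right _ _).trans (min_le_right _ _)
      _ ≤ 1 / 2 := by
          rw [div_mul_eq_mul_div, div_le_div_iff₀ (by positivity) two_pos]
          linarith
  refine ⟨C, D, _, hC, hD, by positivity, hmin, fun ε hε c hc hstep hcN α => ?_⟩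
  have hε1 : ε ≤ 1 := hε.2.trans ((min_le_right _ _).trans (min_le_left _ _))
  have hεg := (mul_le_mul_of_nonneg_right hε.2 hg).trans hmin
  have hs := summable_coeff_mul_pow hγ hε.1 hεg hc hstep
  have hT := dotOp_eq_add_add hZ N (hasSum_dotOp hZ hγ hc hs).summable hcN
  rw [hT]
  refine h ε ⟨hε.1, hε.2.trans (min_le_left _ _)⟩ _ _
    (hsep ε hε.1 hε1 hεg c hc hstep hcN) ?_ ?_ α
  · rw [← hT]
    exact isCompactOperator_dotOp hZ hγ hc hs
  · rw [← hT]
    exact inner_dotOp_comm hZ hγ hc hs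

include hγ in
theorem exists_dotOp_spectral_bounds :
    ∃ C D ε₀ : ℝ, 0 < C ∧ 0 < D ∧ 0 < ε₀ ∧ ε₀ * (2 * ∑ i, γ i) ≤ 1 / 2 ∧
      ∀ ε : ℝ, ε ∈ Set.Icc 0 ε₀ → ∀ c : ℕ → ℝ, (∀ n, 0 ≤ c n) → (∀ n, c (n + 1) ≤ ε * c n) →
        0 < c N → ∀ α : MultiIdx d N,
          Module.finrank ℝ (eigSpan (dotOp hZ γ c)
              (Set.Icc ((c N * ∏ i, γ i ^ α.1 i) * (1 - C * ε))
                ((c N * ∏ i, γ i ^ α.1 i) * (1 + C * ε))))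
            = Module.finrank ℝ (Submodule.span ℝ ((fun β : MultiIdx d N =>
                polyLp hZ (hermPoly β.1)) '' {β | ∏ i, γ i ^ β.1 i = ∏ i, γ i ^ α.1 i})) ∧
          ∃ P Q : Lp ℝ 2 μ →L[ℝ] Lp ℝ 2 μ,
            IsOrthoProj P (Submodule.span ℝ ((fun β : MultiIdx d N =>
                polyLp hZ (hermPoly β.1)) '' {β | ∏ i, γ i ^ β.1 i = ∏ i, γ i ^ α.1 i})) ∧
            IsOrthoProj Q (eigSpan (dotOp hZ γ c)
              (Set.Icc ((c N * ∏ i, γ i ^ α.1 i) * (1 - C * ε))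
                ((c N * ∏ i, γ i ^ α.1 i) * (1 + C * ε)))) ∧
            ‖P - Q‖ ≤ D * ε := by
  obtain ⟨C, D, ε₀, hC, hD, hε₀, hg, h⟩ := exists_dotOp_spectral_bounds_of_coeff_eq_one hZ hγ N
  refine ⟨C, D, ε₀, hC, hD, hε₀, hg, fun ε hε c hc hstep hcN α => ?_⟩
  have heq : dotOp hZ γ c = c N • dotOp hZ γ (fun n => c n / c N) := by
    rw [← dotOp_smul]
    congr 1
    funext n
    field_simp
  rw [heq, mul_assoc, mul_assoc, eigSpan_smul _ hcN]
  refine h ε hε _ (fun n => div_nonneg (hc n) hcN.le) (fun n => ?_) (div_self hcN.ne') α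
  rw [mul_div_assoc']
  exact div_le_div_of_nonneg_right (hstep n) hcN.le

end DotProductSpectrum

section GaussianVector

variable {d : ℕ} {U : Matrix (Fin d) (Fin d) ℝ} {γ : Fin d → ℝ}

/-- The coordinates `Γ^{-1/2} Uᵀ x`. -/
noncomputable def whiten (U : Matrix (Fin d) (Fin d) ℝ) (γ : Fin d → ℝ) (x : Fin d → ℝ) :
    Fin d → ℝ :=
  fun i => (∑ j, U j i * x j) / √(γ i)

theorem whiten_unwhiten (hU : U * U.transpose = 1) (hγ : ∀ i, 0 < γ i) (z : Fin d → ℝ) :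
    whiten U γ (fun i => ∑ j, U i j * (√(γ j) * z j)) = z := by
  funext i
  have h1 : U.transpose.mulVec (U.mulVec fun j => √(γ j) * z j) i = √(γ i) * z i := by
    rw [Matrix.mulVec_mulVec, mul_eq_one_comm.mp hU, Matrix.one_mulVec]
  have h2 : √(γ i) ≠ 0 := (Real.sqrt_pos.mpr (hγ i)).ne'
  rw [whiten, div_eq_iff h2, mul_comm (z i), ← h1]
  rfl

theorem measurePreserving_whiten (hU : U * U.transpose = 1) (hγ : ∀ i, 0 < γ i) :
    MeasurePreserving (whiten U γ) (gaussianVec d U γ) (stdGaussianPi d) := by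
  have hm : Measurable (whiten U γ) := by
    unfold whiten
    fun_prop
  refine ⟨hm, ?_⟩
  rw [gaussianVec, Measure.map_map hm (by fun_prop)]
  convert! Measure.map_id using 2
  exact funext fun z => whiten_unwhiten hU hγ z

theorem sum_mul_eq_sum_whiten (hU : U * U.transpose = 1) (hγ : ∀ i, 0 < γ i) (x y : Fin d → ℝ) :
    ∑ i, x i * y i = ∑ i, γ i * whiten U γ x i * whiten U γ y i := by
  have h1 : ∀ i, γ i * whiten U γ x i * whiten U γ y i
      = U.transpose.mulVec x i * U.transpose.mulVec y i := by
    intro i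
    have h2 : √(γ i) ≠ 0 := (Real.sqrt_pos.mpr (hγ i)).ne'
    have h3 : γ i = √(γ i) * √(γ i) := (Real.mul_self_sqrt (hγ i).le).symm
    change γ i * (U.transpose.mulVec x i / √(γ i)) * (U.transpose.mulVec y i / √(γ i)) = _
    rw [h3, Real.sqrt_mul_self (Real.sqrt_nonneg _)]
    field_simp
  simp only [h1]
  change dotProduct x y = dotProduct (U.transpose.mulVec x) (U.transpose.mulVec y)
  rw [Matrix.dotProduct_mulVec, Matrix.vecMul_transpose, Matrix.mulVec_mulVec, hU,
    Matrix.one_mulVec]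

theorem hermMulti_eq_eval (β : Fin d → ℕ) (x : Fin d → ℝ) :
    hermMulti d U γ β x = MvPolynomial.eval (whiten U γ x) (hermPoly β) :=
  (eval_hermPoly β _).symm

theorem hermiteLevelSpan_eq (hU : U * U.transpose = 1) (hγ : ∀ i, 0 < γ i) {N : ℕ}
    (α : Fin d → ℕ) :
    hermiteLevelSpan d U γ N α = Submodule.span ℝ ((fun β : MultiIdx d N =>
      polyLp (measurePreserving_whiten hU hγ) (hermPoly β.1)) ''
        {β | ∏ i, γ i ^ β.1 i = ∏ i, γ i ^ α i}) := by
  have hcoe : ∀ β : Fin d → ℕ, polyLp (measurePreserving_whiten hU hγ) (hermPoly β)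
      =ᵐ[gaussianVec d U γ] hermMulti d U γ β := fun β =>
    (coeFn_polyLp _ _).trans (Filter.Eventually.of_forall fun x => (hermMulti_eq_eval β x).symm)
  rw [hermiteLevelSpan]
  congr 1
  ext f
  constructor
  · rintro ⟨β, hβ, hβα, hf⟩
    exact ⟨⟨β, by simp [Finset.mem_piAntidiag, hβ]⟩, hβα, Lp.ext ((hcoe β).trans hf.symm)⟩
  · rintro ⟨β, hβα, rfl⟩
    exact ⟨β.1, β.sum_eq, hβα, hcoe β.1⟩

end GaussianVector

/-- **The HEA for fast-decaying dot-product kernels on `N(0,Σ)`** (rigorous form).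
For every `N` there are `C_N, D_N, ε_N > 0` such that for every `ε ∈ [0, ε_N]` and
every `ε`-fast-decaying nonnegative sequence `(c_n)` with `c_N > 0`: the dot-product
kernel `K(x,y) = Σ_n (c_n/n!)(xᵀy)^n` is pointwise absolutely convergent and defines
a positive self-adjoint trace-class integral operator `T` on `L²(μ)`; and for every
multi-index `α` with `|α| = N`, setting `λ = c_N ∏_i γ_i^{α_i}` and
`V = span{h_β^{(Σ)} : |β| = N, ∏γ^β = ∏γ^α}`, the number of eigenvalues of `T`
(with multiplicity) in `[λ(1−C_N ε), λ(1+C_N ε)]` is exactly `dim V`; the span `V′`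
of the corresponding eigenfunctions has `dim V′ = dim V` and the orthogonal
projections satisfy `‖P_V − P_{V′}‖ ≤ D_N ε`. -/
theorem hea_dot_product_kernel
    (d : ℕ) (Sig U : Matrix (Fin d) (Fin d) ℝ) (γv : Fin d → ℝ)
    (hPD : Sig.PosDef) (hU : U * U.transpose = 1) (hγ : ∀ i, 0 < γv i)
    (hdecomp : Sig = U * Matrix.diagonal γv * U.transpose) (N : ℕ) :
    ∃ C D ε₀ : ℝ, 0 < C ∧ 0 < D ∧ 0 < ε₀ ∧
      ∀ ε : ℝ, ε ∈ Set.Icc 0 ε₀ →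
      ∀ c : ℕ → ℝ, (∀ n, 0 ≤ c n) → (∀ n, c (n + 1) ≤ ε * c n) → 0 < c N →
        (∀ x y : Fin d → ℝ,
          Summable fun n : ℕ =>
            |c n / (Nat.factorial n) * (∑ i, x i * y i) ^ n|) ∧
        Integrable
          (fun x : Fin d → ℝ =>
            ∑' n : ℕ, c n / (Nat.factorial n) * (∑ i, x i * x i) ^ n)
          (gaussianVec d U γv) ∧
        ∃ T : Lp ℝ 2 (gaussianVec d U γv) →L[ℝ] Lp ℝ 2 (gaussianVec d U γv),
          (∀ f : Lp ℝ 2 (gaussianVec d U γv),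
            (T f : (Fin d → ℝ) → ℝ) =ᵐ[gaussianVec d U γv]
              fun x => ∫ y,
                (∑' n : ℕ, c n / (Nat.factorial n) * (∑ i, x i * y i) ^ n) * f y
                ∂(gaussianVec d U γv)) ∧
          (∀ f g, ⟪T f, g⟫_ℝ = ⟪f, T g⟫_ℝ) ∧
          (∀ f, (0 : ℝ) ≤ ⟪f, T f⟫_ℝ) ∧
          ∀ α : Fin d → ℕ, (∑ i, α i) = N →
            Module.finrank ℝ
                (eigSpanIcc d U γv T ((c N * ∏ i, γv i ^ α i) * (1 - C * ε))
                  ((c N * ∏ i, γv i ^ α i) * (1 + C * ε)))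
              = Module.finrank ℝ (hermiteLevelSpan d U γv N α) ∧
            ∃ P Q : Lp ℝ 2 (gaussianVec d U γv) →L[ℝ] Lp ℝ 2 (gaussianVec d U γv),
              IsOrthoProj P (hermiteLevelSpan d U γv N α) ∧
              IsOrthoProj Q
                (eigSpanIcc d U γv T ((c N * ∏ i, γv i ^ α i) * (1 - C * ε))
                  ((c N * ∏ i, γv i ^ α i) * (1 + C * ε))) ∧
              ‖P - Q‖ ≤ D * ε := by
  have hZ := measurePreserving_whiten hU hγ
  obtain ⟨C, D, ε₀, hC, hD, hε₀, hg, h⟩ := exists_dotOp_spectral_bounds hZ hγ N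
  refine ⟨C, D, ε₀, hC, hD, hε₀, fun ε hε c hc hstep hcN => ?_⟩
  have hγs : 0 ≤ 2 * ∑ i, γv i := mul_nonneg zero_le_two (Finset.sum_nonneg fun i _ => (hγ i).le)
  have hs := summable_coeff_mul_pow hγ hε.1
    ((mul_le_mul_of_nonneg_right hε.2 hγs).trans hg) hc hstep
  have hk := summable_abs_coeff_mul_pow (B := c 0) (r := ε) hc
    fun n => (coeff_le_mul_pow hε.1 hstep 0 n).trans_eq (mul_comm _ _)
  have hxy := sum_mul_eq_sum_whiten hU hγ
  refine ⟨fun x y => hk _, ?_, dotOp hZ γv c, fun f => ?_, inner_dotOp_comm hZ hγ hc hs,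
    inner_dotOp_self_nonneg hZ hγ hc hs, fun α hα => ?_⟩
  · simpa only [← hxy] using integrable_diag_kernel hZ hγ hc hs
  · simpa only [← hxy] using coeFn_dotOp hZ hγ hc hs hk f
  · rw [hermiteLevelSpan_eq hU hγ]
    exact h ε hε c hc hstep hcN ⟨α, by simp [Finset.mem_piAntidiag, hα]⟩
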